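/- Let X be a locally compact Hausdorff space that is perfectly normal (X is normal and every closed subset of X is a countable intersection of open sets) and σ-compact, and let κ be a perfect kernel on X (strictly positive definite and consistent). Then every Borel set B ⊂ X is capacitable: c_*(B) = c^*(B). -/

import Mathlib

open MeasureTheory Filter Topology Set
open scoped ENNReal NNReal

namespace Balayage

variable {X : Type*} [TopologicalSpace X] [T2Space X] [LocallyCompactSpace X]
  [MeasurableSpace X] [BorelSpace X]

/-- The potential `κμ(x) := ∫ κ(x,y) dμ(y)`. -/
noncomputable def pot (κ : X → X → ℝ≥0∞) (μ : Measure X) (x : X) : ℝ≥0∞ :=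
  ∫⁻ y, κ x y ∂μ

/-- The mutual energy `κ(μ,ν) := ∬ κ(x,y) d(μ⊗ν)(x,y)`. -/
noncomputable def energy (κ : X → X → ℝ≥0∞) (μ ν : Measure X) : ℝ≥0∞ :=
  ∫⁻ x, pot κ ν x ∂μ

/-- A positive Radon measure: locally finite and inner regular. -/
def IsRadon (μ : Measure X) : Prop :=
  μ.InnerRegular ∧ IsLocallyFiniteMeasure μ

/-- `E⁺`: the positive Radon measures of finite energy. -/
def Eplus (κ : X → X → ℝ≥0∞) : Set (Measure X) :=
  {μ | IsRadon μ ∧ energy κ μ μ < ⊤}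

/-- `μ` is concentrated on `A`: `A` is `μ`-measurable and `X∖A` is locally `μ`-negligible. -/
def ConcOn (μ : Measure X) (A : Set X) : Prop :=
  NullMeasurableSet A μ ∧ ∀ K : Set X, IsCompact K → μ (Aᶜ ∩ K) = 0

/-- `E⁺_A`: measures of finite energy concentrated on `A`. -/
def EplusOn (κ : X → X → ℝ≥0∞) (A : Set X) : Set (Measure X) :=
  {μ ∈ Eplus κ | ConcOn μ A}

/-- The inner capacity `c_*(A)`. -/
noncomputable def innerCap (κ : X → X → ℝ≥0∞) (A : Set X) : ℝ≥0∞ :=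
  (⨅ μ ∈ {μ ∈ EplusOn κ A | μ Set.univ = 1}, energy κ μ μ)⁻¹

/-- `P` holds nearly everywhere on `A`: the set where it fails has inner capacity zero. -/
def NEOn (κ : X → X → ℝ≥0∞) (A : Set X) (P : X → Prop) : Prop :=
  innerCap κ {x | x ∈ A ∧ ¬ P x} = 0

/-- The outer capacity `c^*(A)`. -/
noncomputable def outerCap (κ : X → X → ℝ≥0∞) (A : Set X) : ℝ≥0∞ :=
  ⨅ D ∈ {D : Set X | IsOpen D ∧ A ⊆ D}, innerCap κ D

/-- `P` holds quasi-everywhere on `A`: the set where it fails has outer capacity zero. -/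
def QEOn (κ : X → X → ℝ≥0∞) (A : Set X) (P : X → Prop) : Prop :=
  outerCap κ {x | x ∈ A ∧ ¬ P x} = 0

/-- The class `Λ_{A,μ}` of measures `ν ∈ E⁺` with `κν ≥ κμ` n.e. on `A`. -/
def InnerLam (κ : X → X → ℝ≥0∞) (A : Set X) (μ : Measure X) : Set (Measure X) :=
  {ν ∈ Eplus κ | NEOn κ A (fun x => pot κ μ x ≤ pot κ ν x)}

/-- The class `Λ*_{A,μ}` of measures `ν ∈ E⁺` with `κν ≥ κμ` q.e. on `A`. -/
def OuterLam (κ : X → X → ℝ≥0∞) (A : Set X) (μ : Measure X) : Set (Measure X) :=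
  {ν ∈ Eplus κ | QEOn κ A (fun x => pot κ μ x ≤ pot κ ν x)}

/-- `b` is the inner balayage `μ^A`: the measure of minimal potential in `Λ_{A,μ}`. -/
def IsInnerBal (κ : X → X → ℝ≥0∞) (A : Set X) (μ b : Measure X) : Prop :=
  b ∈ InnerLam κ A μ ∧ ∀ ν ∈ InnerLam κ A μ, ∀ x, pot κ b x ≤ pot κ ν x

/-- `b` is the outer balayage `μ^{*A}`: the measure of minimal potential in `Λ*_{A,μ}`. -/
def IsOuterBal (κ : X → X → ℝ≥0∞) (A : Set X) (μ b : Measure X) : Prop :=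
  b ∈ OuterLam κ A μ ∧ ∀ ν ∈ OuterLam κ A μ, ∀ x, pot κ b x ≤ pot κ ν x

/-- The strong (energy) distance `‖μ − ν‖`. -/
noncomputable def strDist (κ : X → X → ℝ≥0∞) (μ ν : Measure X) : ℝ :=
  Real.sqrt ((energy κ μ μ).toReal - 2 * (energy κ μ ν).toReal + (energy κ ν ν).toReal)

/-- The energy principle (strict positive definiteness). -/
def EnergyPrinciple (κ : X → X → ℝ≥0∞) : Prop :=
  ∀ μ ∈ Eplus κ, ∀ ν ∈ Eplus κ,
    2 * energy κ μ ν ≤ energy κ μ μ + energy κ ν ν ∧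
      (2 * energy κ μ ν = energy κ μ μ + energy κ ν ν → μ = ν)

/-- Vague convergence of a net of measures along a filter. -/
def VagueConv {ι : Type*} (F : Filter ι) (m : ι → Measure X) (ν : Measure X) : Prop :=
  ∀ f : X → ℝ, Continuous f → HasCompactSupport f →
    Tendsto (fun i => ∫ x, f x ∂(m i)) F (nhds (∫ x, f x ∂ν))

/-- A net of measures is strong Cauchy (for the energy metric) along a filter. -/
def StrongCauchy (κ : X → X → ℝ≥0∞) {ι : Type*} (F : Filter ι) (m : ι → Measure X) : Prop :=
  ∀ ε : ℝ, 0 < ε → ∃ s ∈ F, ∀ i ∈ s, ∀ j ∈ s, strDist κ (m i) (m j) < ε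

/-- The consistency principle: every strong Cauchy net in `E⁺` converges strongly
to each of its vague limit points. -/
def Consistent (κ : X → X → ℝ≥0∞) : Prop :=
  ∀ (ι : Type) (F : Filter ι) (m : ι → Measure X), F.NeBot →
    (∀ i, m i ∈ Eplus κ) → StrongCauchy κ F m →
    ∀ ν : Measure X, (∃ G : Filter ι, G ≤ F ∧ G.NeBot ∧ VagueConv G m ν) →
      Tendsto (fun i => strDist κ (m i) ν) F (nhds 0)

/-- The domination principle. -/
def Domination (κ : X → X → ℝ≥0∞) : Prop :=
  ∀ μ ∈ Eplus κ, ∀ ν ∈ Eplus κ,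
    (∀ᵐ x ∂μ, pot κ μ x ≤ pot κ ν x) → ∀ x, pot κ μ x ≤ pot κ ν x

/-- A kernel: symmetric and lower semicontinuous. -/
structure IsKernel (κ : X → X → ℝ≥0∞) : Prop where
  symm : ∀ x y, κ x y = κ y x
  lsc : LowerSemicontinuous (Function.uncurry κ)

/-- `E'_A`: the strong closure of `E⁺_A` within `E⁺`. -/
def EclosOn (κ : X → X → ℝ≥0∞) (A : Set X) : Set (Measure X) :=
  {ν ∈ Eplus κ | ∀ ε : ℝ, 0 < ε → ∃ μ ∈ EplusOn κ A, strDist κ ν μ < ε}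

/-- The (real-valued) potential of the signed measure `λ = lp − lm`. -/
noncomputable def spot (κ : X → X → ℝ≥0∞) (lp lm : Measure X) (x : X) : ℝ :=
  (pot κ lp x).toReal - (pot κ lm x).toReal

/-- Assumption (A2): every `f ∈ C_c(X)` is the limit, uniformly with supports in one fixed
compact set, of a sequence of potentials of signed measures of finite energy that are
continuous and compactly supported. -/
def A2 (κ : X → X → ℝ≥0∞) : Prop :=
  ∀ f : X → ℝ, Continuous f → HasCompactSupport f →
    ∃ (K : Set X) (lp lm : ℕ → Measure X), IsCompact K ∧ tsupport f ⊆ K ∧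
      (∀ j, lp j ∈ Eplus κ ∧ lm j ∈ Eplus κ) ∧
      (∀ j x, pot κ (lp j) x ≠ ⊤ ∨ pot κ (lm j) x ≠ ⊤) ∧
      (∀ j, Continuous (spot κ (lp j) (lm j))) ∧
      (∀ j, tsupport (spot κ (lp j) (lm j)) ⊆ K) ∧
      TendstoUniformly (fun j => spot κ (lp j) (lm j)) f atTop

set_option linter.unusedSectionVars false
open scoped CompactlySupported

/-- `θ < 1` can be inserted in a strict inequality. -/
lemma exists_lt_one_lt_mul {a A : ℝ≥0∞} (h : a < A) : ∃ θ : ℝ≥0∞, θ < 1 ∧ a < θ * A := by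
  have hA : A ≠ 0 := (bot_le.trans_lt h).ne'
  have h1 : a / A < 1 := by
    rw [ENNReal.div_lt_iff (Or.inl hA) (Or.inr h.ne_top), one_mul]
    exact h
  obtain ⟨θ, h2, h3⟩ := exists_between h1
  exact ⟨θ, h3, by rwa [ENNReal.div_lt_iff (Or.inl hA) (Or.inr h.ne_top)] at h2⟩

lemma mul_measure_le_iSup_setLIntegral {ι : Type*} [Nonempty ι] (μ : Measure X)
    [μ.InnerRegular] {g : ι → X → ℝ≥0∞} (hd : Directed (· ≤ ·) g)
    (hl : ∀ i, LowerSemicontinuous (g i)) {B : Set X} (hB : MeasurableSet B) {c : ℝ≥0∞}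
    (hc : ∀ x ∈ B, c < ⨆ i, g i x) : c * μ B ≤ ⨆ i, ∫⁻ x in B, g i x ∂μ := by
  rw [hB.measure_eq_iSup_isCompact, ENNReal.mul_iSup]
  refine iSup_le fun K => ?_
  rw [ENNReal.mul_iSup]
  refine iSup_le fun hKB => ?_
  rw [ENNReal.mul_iSup]
  refine iSup_le fun hK => ?_
  obtain ⟨i, hi⟩ := hK.elim_directed_cover (fun i => {x | c < g i x})
    (fun i => (hl i).isOpen_preimage c)
    (fun x hx => by
      obtain ⟨i, hi⟩ := lt_iSup_iff.1 (hc x (hKB hx))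
      exact mem_iUnion.2 ⟨i, hi⟩)
    (fun i j => by
      obtain ⟨k, h1, h2⟩ := hd i j
      exact ⟨k, fun x hx => lt_of_lt_of_le hx (h1 x), fun x hx => lt_of_lt_of_le hx (h2 x)⟩)
  refine le_iSup_of_le i ?_
  calc c * μ K = ∫⁻ _ in K, c ∂μ := by simp
    _ ≤ ∫⁻ x in K, g i x ∂μ := setLIntegral_mono' hK.measurableSet fun x hx => (hi hx).le
    _ ≤ ∫⁻ x in B, g i x ∂μ := lintegral_mono_set hKB

/-- `τ`-additivity: for an inner regular measure the integral commutes with directed suprema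
of lower semicontinuous functions. -/
theorem lintegral_iSup_of_directed_of_lsc {ι : Type*} [Nonempty ι] (μ : Measure X)
    [μ.InnerRegular] {g : ι → X → ℝ≥0∞} (hd : Directed (· ≤ ·) g)
    (hl : ∀ i, LowerSemicontinuous (g i)) :
    ∫⁻ x, ⨆ i, g i x ∂μ = ⨆ i, ∫⁻ x, g i x ∂μ := by
  refine le_antisymm ?_ (iSup_lintegral_le _)
  rw [lintegral_eq_nnreal]
  refine iSup₂_le fun φ hφ => ?_
  refine le_of_forall_lt fun a ha => ?_
  obtain ⟨θ, hθ, haθ⟩ := exists_lt_one_lt_mul ha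
  refine haθ.trans_le ?_
  rw [SimpleFunc.map_lintegral, Finset.mul_sum]
  have key : ∀ c ∈ φ.range, θ * (c * μ (φ ⁻¹' {c})) ≤ ⨆ i, ∫⁻ x in φ ⁻¹' {c}, g i x ∂μ := by
    intro c _
    rcases eq_or_ne c 0 with rfl | hc
    · simp
    rw [← mul_assoc]
    refine mul_measure_le_iSup_setLIntegral μ hd hl (φ.measurableSet_fiber c) fun x hx => ?_
    refine lt_of_lt_of_le ?_ (hφ x)
    rw [show φ x = c from hx]
    simpa using ENNReal.mul_lt_mul_left (by simpa using hc) ENNReal.coe_ne_top hθ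
  refine (Finset.sum_le_sum key).trans ?_
  rw [ENNReal.finsetSum_iSup]
  · refine iSup_mono fun i => ?_
    rw [← lintegral_biUnion_finset (fun a _ b _ hab => ?_) (fun c _ => φ.measurableSet_fiber c)]
    · exact setLIntegral_le_lintegral _ _
    · exact Disjoint.preimage _ (by simpa using hab)
  · intro i j
    obtain ⟨k, h1, h2⟩ := hd i j
    exact ⟨k, fun c => ⟨lintegral_mono h1, lintegral_mono h2⟩⟩

lemma exists_compactlySupported_between {g : X → ℝ≥0∞} (hg : LowerSemicontinuous g) {x : X}
    {a : ℝ≥0} (ha : a < g x) : ∃ f : X → ℝ, Continuous f ∧ HasCompactSupport f ∧ (∀ y, 0 ≤ f y) ∧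
      (∀ y, ENNReal.ofReal (f y) ≤ g y) ∧ f x = a := by
  have hU : IsOpen {y | (a : ℝ≥0∞) < g y} := hg.isOpen_preimage _
  obtain ⟨f, h1, h2, h3, h4⟩ := exists_continuous_one_zero_of_isCompact (isCompact_singleton (x := x))
    hU.isClosed_compl (by simpa using ha)
  refine ⟨fun y => a * f y, by fun_prop, h3.mul_left, fun y => mul_nonneg a.2 (h4 y).1, fun y => ?_,
    by simp [h1 (mem_singleton x)]⟩
  by_cases hy : (a : ℝ≥0∞) < g y
  · refine le_trans ?_ hy.le
    rw [← ENNReal.ofReal_coe_nnreal]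
    exact ENNReal.ofReal_le_ofReal (mul_le_of_le_one_right a.2 (h4 y).2)
  · simp [h2 (show y ∈ {y | (a : ℝ≥0∞) < g y}ᶜ from hy)]

/-- Integration of lower semicontinuous functions is vaguely lower semicontinuous. -/
theorem VagueConv.eventually_lt_lintegral {ι : Type*} {G : Filter ι} {m : ι → Measure X}
    {ν : Measure X} (h : VagueConv G m ν) [ν.InnerRegular] [IsLocallyFiniteMeasure ν]
    (hm : ∀ i, IsLocallyFiniteMeasure (m i)) {g : X → ℝ≥0∞} (hg : LowerSemicontinuous g)
    {a : ℝ≥0∞} (ha : a < ∫⁻ x, g x ∂ν) : ∀ᶠ i in G, a < ∫⁻ x, g x ∂(m i) := by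
  let S := {f : X → ℝ // Continuous f ∧ HasCompactSupport f ∧ (∀ y, 0 ≤ f y) ∧
      (∀ y, ENNReal.ofReal (f y) ≤ g y)}
  have : Nonempty S := ⟨⟨fun _ => 0, continuous_const, HasCompactSupport.zero, by simp, by simp⟩⟩
  have hsup : ∀ x, g x = ⨆ f : S, ENNReal.ofReal (f.1 x) := by
    intro x
    refine le_antisymm (ENNReal.le_of_forall_nnreal_lt fun a ha => ?_) (iSup_le fun f => f.2.2.2.2 x)
    obtain ⟨f, h1, h2, h3, h4, h5⟩ := exists_compactlySupported_between hg ha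
    refine le_iSup_of_le (⟨f, h1, h2, h3, h4⟩ : S) ?_
    simp [h5]
  simp_rw [hsup] at ha
  rw [lintegral_iSup_of_directed_of_lsc ν] at ha
  · obtain ⟨⟨f, h1, h2, h3, h4⟩, hf⟩ := lt_iSup_iff.1 ha
    dsimp only at hf
    rw [← ofReal_integral_eq_lintegral_ofReal (h1.integrable_of_hasCompactSupport h2)
      (ae_of_all _ h3)] at hf
    have := (ENNReal.continuous_ofReal.tendsto _).comp (h f h1 h2)
    filter_upwards [this.eventually_const_lt hf] with i hi
    have := hm i
    refine hi.trans_le ?_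
    rw [Function.comp_apply, ofReal_integral_eq_lintegral_ofReal
      (h1.integrable_of_hasCompactSupport h2) (ae_of_all _ h3)]
    exact lintegral_mono h4
  · rintro ⟨f, h1, h2, h3, h4⟩ ⟨f', h1', h2', h3', h4'⟩
    refine ⟨⟨fun x => max (f x) (f' x), h1.max h1', h2.comp₂_left h2' (by simp),
      fun y => le_max_of_le_left (h3 y), fun y => ?_⟩, fun y => ?_, fun y => ?_⟩
    · rw [ENNReal.ofReal_max]
      exact max_le (h4 y) (h4' y)
    · exact ENNReal.ofReal_le_ofReal (le_max_left _ _)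
    · exact ENNReal.ofReal_le_ofReal (le_max_right _ _)
  · exact fun f => (ENNReal.continuous_ofReal.comp f.2.1).lowerSemicontinuous

/-- Relatively compact open boxes `U × V` together with a constant `c` such that `c ≤ κ`
on `U × V`. -/
def Box (κ : X → X → ℝ≥0∞) : Type _ :=
  {b : ℝ≥0 × Set X × Set X // IsOpen b.2.1 ∧ IsOpen b.2.2 ∧ IsCompact (closure b.2.2) ∧
    ∀ x ∈ b.2.1, ∀ y ∈ b.2.2, (b.1 : ℝ≥0∞) ≤ κ x y}

/-- The supremum of `c • 1_V` over finitely many boxes. -/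
noncomputable def sideSup {κ : X → X → ℝ≥0∞} (J : Finset (Box κ)) (y : X) : ℝ≥0∞ :=
  ⨆ b ∈ J, b.1.2.2.indicator (fun _ => (b.1.1 : ℝ≥0∞)) y

open Classical in
/-- The supremum of `c • 1_{U × V}` over finitely many boxes. -/
noncomputable def boxSup {κ : X → X → ℝ≥0∞} (J : Finset (Box κ)) (x y : X) : ℝ≥0∞ :=
  sideSup (J.filter fun b => x ∈ b.1.2.1) y

lemma boxSup_eq {κ : X → X → ℝ≥0∞} (J : Finset (Box κ)) (x y : X) :
    boxSup J x y = ⨆ b ∈ J, b.1.2.1.indicator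
      (fun _ => b.1.2.2.indicator (fun _ => (b.1.1 : ℝ≥0∞)) y) x := by
  classical
  simp only [boxSup, sideSup, Finset.mem_filter, iSup_and]
  congr! with b hb
  by_cases hx : x ∈ b.1.2.1 <;> simp [hx]

lemma boxSup_mono {κ : X → X → ℝ≥0∞} (x y : X) :
    Monotone fun J : Finset (Box κ) => boxSup J x y := by
  intro J J' h
  simp only [boxSup_eq]
  exact biSup_mono h

lemma directed_boxSup {κ : X → X → ℝ≥0∞} (x : X) :
    Directed (· ≤ ·) fun J : Finset (Box κ) => boxSup J x := by
  classical
  exact Monotone.directed_le fun J J' h y => boxSup_mono x y h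

lemma lowerSemicontinuous_sideSup {κ : X → X → ℝ≥0∞} (J : Finset (Box κ)) :
    LowerSemicontinuous (sideSup J) :=
  lowerSemicontinuous_biSup fun b _ => b.2.2.1.lowerSemicontinuous_indicator (by simp)

lemma iSup_boxSup {κ : X → X → ℝ≥0∞} (hκ : LowerSemicontinuous (Function.uncurry κ)) (x y : X) :
    ⨆ J : Finset (Box κ), boxSup J x y = κ x y := by
  classical
  refine le_antisymm (iSup_le fun J => ?_) (ENNReal.le_of_forall_nnreal_lt fun a ha => ?_)
  · rw [boxSup_eq]
    refine iSup₂_le fun b _ => ?_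
    by_cases hx : x ∈ b.1.2.1 <;> by_cases hy : y ∈ b.1.2.2 <;> simp [hx, hy]
    exact b.2.2.2.2 x hx y hy
  · have ho : IsOpen {p : X × X | (a : ℝ≥0∞) < Function.uncurry κ p} := hκ.isOpen_preimage _
    obtain ⟨U, V, hU, hV, hx, hy, hUV⟩ := isOpen_prod_iff.1 ho x y ha
    obtain ⟨W, hW, hyW, hWV, hWc⟩ := exists_open_between_and_isCompact_closure
      (isCompact_singleton (x := y)) hV (by simpa using hy)
    let b : Box κ := ⟨(a, U, W), hU, hW, hWc, fun x hx y hy =>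
      (mem_ofPred.1 (hUV (mk_mem_prod hx (hWV (subset_closure hy))))).le⟩
    refine le_iSup_of_le {b} ?_
    rw [boxSup_eq]
    refine le_iSup₂_of_le b (Finset.mem_singleton_self b) ?_
    have hyW' : y ∈ W := hyW rfl
    simp [b, hx, hyW']

lemma measurable_uncurry_boxSup {κ : X → X → ℝ≥0∞} (J : Finset (Box κ)) :
    Measurable (Function.uncurry (boxSup J)) := by
  have : Function.uncurry (boxSup J) = fun p : X × X => ⨆ b ∈ J, (b.1.2.1 ×ˢ b.1.2.2).indicator
      (fun _ => (b.1.1 : ℝ≥0∞)) p := by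
    ext ⟨x, y⟩
    simp only [Function.uncurry_apply_pair, boxSup_eq]
    congr! with b hb
    by_cases hx : x ∈ b.1.2.1 <;> by_cases hy : y ∈ b.1.2.2 <;> simp [hx, hy]
  rw [this]
  exact Measurable.biSup _ J.countable_toSet fun b _ => measurable_const.indicator
    (b.2.1.measurableSet.prod b.2.2.1.measurableSet)

lemma lowerSemicontinuous_lintegral_boxSup {κ : X → X → ℝ≥0∞} (J : Finset (Box κ))
    (ν : Measure X) : LowerSemicontinuous fun x => ∫⁻ y, boxSup J x y ∂ν := by
  classical
  intro x a ha
  have hW : (⋂ b ∈ J.filter fun b => x ∈ b.1.2.1, b.1.2.1) ∈ 𝓝 x := by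
    refine (Filter.biInter_finset_mem _).2 fun b hb => ?_
    exact b.2.1.mem_nhds (Finset.mem_filter.1 hb).2
  filter_upwards [hW] with z hz
  refine lt_of_lt_of_le ha (lintegral_mono fun y => ?_)
  refine biSup_mono fun b hb => ?_
  rw [Finset.mem_filter] at hb ⊢
  exact ⟨hb.1, mem_iInter₂.1 hz b (Finset.mem_filter.2 hb)⟩

section Potential

variable {κ : X → X → ℝ≥0∞}

lemma pot_eq_iSup (hκ : LowerSemicontinuous (Function.uncurry κ)) (ν : Measure X)
    [ν.InnerRegular] (x : X) :
    pot κ ν x = ⨆ J : Finset (Box κ), ∫⁻ y, boxSup J x y ∂ν := by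
  rw [← lintegral_iSup_of_directed_of_lsc ν (directed_boxSup x)
    (fun J => lowerSemicontinuous_sideSup _)]
  simp [pot, iSup_boxSup hκ]

/-- Potentials of inner regular measures are lower semicontinuous. -/
theorem lowerSemicontinuous_pot (hκ : LowerSemicontinuous (Function.uncurry κ)) (ν : Measure X)
    [ν.InnerRegular] : LowerSemicontinuous (pot κ ν) := by
  have : pot κ ν = fun x => ⨆ J : Finset (Box κ), ∫⁻ y, boxSup J x y ∂ν :=
    funext (pot_eq_iSup hκ ν)
  rw [this]
  exact lowerSemicontinuous_iSup fun J => lowerSemicontinuous_lintegral_boxSup J ν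

lemma energy_eq_iSup (hκ : LowerSemicontinuous (Function.uncurry κ)) (μ ν : Measure X)
    [μ.InnerRegular] [ν.InnerRegular] :
    energy κ μ ν = ⨆ J : Finset (Box κ), ∫⁻ x, ∫⁻ y, boxSup J x y ∂ν ∂μ := by
  classical
  rw [← lintegral_iSup_of_directed_of_lsc μ
    (g := fun (J : Finset (Box κ)) x => ∫⁻ y, boxSup J x y ∂ν)
    (Monotone.directed_le fun J J' h x => lintegral_mono fun y => boxSup_mono x y h)
    (fun J => lowerSemicontinuous_lintegral_boxSup J ν)]
  simp [energy, pot_eq_iSup hκ]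

/-- The mutual energy is symmetric. -/
theorem energy_comm (hκ : IsKernel κ) (μ ν : Measure X) [μ.InnerRegular] [ν.InnerRegular]
    [SFinite μ] [SFinite ν] : energy κ μ ν = energy κ ν μ := by
  classical
  have h1 : energy κ μ ν = ∫⁻ y, ∫⁻ x, κ x y ∂μ ∂ν := by
    rw [energy_eq_iSup hκ.lsc]
    simp_rw [fun J : Finset (Box κ) => lintegral_lintegral_swap (μ := μ) (ν := ν)
      (measurable_uncurry_boxSup J).aemeasurable]
    have hlsc (J : Finset (Box κ)) (y : X) : LowerSemicontinuous fun x => boxSup J x y := by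
      simp_rw [boxSup_eq]
      exact lowerSemicontinuous_biSup fun b _ => b.2.1.lowerSemicontinuous_indicator (by simp)
    have hlsc' (J : Finset (Box κ)) : LowerSemicontinuous fun y => ∫⁻ x, boxSup J x y ∂μ := by
      intro y a ha
      have hW : (⋂ b ∈ J.filter fun b => y ∈ b.1.2.2, b.1.2.2) ∈ 𝓝 y := by
        refine (Filter.biInter_finset_mem _).2 fun b hb => ?_
        exact b.2.2.1.mem_nhds (Finset.mem_filter.1 hb).2
      filter_upwards [hW] with z hz
      refine lt_of_lt_of_le ha (lintegral_mono fun x => ?_)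
      simp only [boxSup_eq]
      refine iSup₂_mono fun b hb => ?_
      by_cases hx : x ∈ b.1.2.1 <;> simp only [hx, indicator_of_mem, indicator_of_notMem,
        not_false_eq_true, le_refl]
      by_cases hy : y ∈ b.1.2.2
      · have : z ∈ b.1.2.2 := mem_iInter₂.1 hz b (Finset.mem_filter.2 ⟨hb, hy⟩)
        simp [hy, this]
      · simp [hy]
    rw [← lintegral_iSup_of_directed_of_lsc ν
      (Monotone.directed_le fun J J' h y => lintegral_mono fun x => boxSup_mono x y h) hlsc']
    refine lintegral_congr fun y => ?_
    rw [← lintegral_iSup_of_directed_of_lsc μ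
      (Monotone.directed_le fun J J' h x => boxSup_mono x y h) (fun J => hlsc J y)]
    simp [iSup_boxSup hκ.lsc]
  rw [h1]
  simp only [energy, pot]
  simp_rw [hκ.symm]

lemma lintegral_sideSup_lt_top (J : Finset (Box κ)) (ν : Measure X) [IsLocallyFiniteMeasure ν] :
    ∫⁻ y, sideSup J y ∂ν < ∞ := by
  calc ∫⁻ y, sideSup J y ∂ν
      ≤ ∫⁻ y, ∑ b ∈ J, b.1.2.2.indicator (fun _ => (b.1.1 : ℝ≥0∞)) y ∂ν :=
        lintegral_mono fun y => iSup₂_le fun b hb =>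
          Finset.single_le_sum (f := fun b : Box κ => b.1.2.2.indicator
            (fun _ => (b.1.1 : ℝ≥0∞)) y) (fun _ _ => zero_le) hb
    _ = ∑ b ∈ J, b.1.1 * ν b.1.2.2 := by
        rw [lintegral_finsetSum _ fun b _ => measurable_const.indicator b.2.2.1.measurableSet]
        exact Finset.sum_congr rfl fun b _ => lintegral_indicator_const b.2.2.1.measurableSet _
    _ < ∞ := ENNReal.sum_lt_top.2 fun b _ => ENNReal.mul_lt_top ENNReal.coe_lt_top
        ((measure_mono subset_closure).trans_lt b.2.2.2.1.measure_lt_top)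

/-- The energy is vaguely lower semicontinuous. -/
theorem VagueConv.eventually_lt_energy (hκ : LowerSemicontinuous (Function.uncurry κ))
    {ι : Type*} {G : Filter ι} {m : ι → Measure X} {ν : Measure X} (h : VagueConv G m ν)
    (hν : IsRadon ν) (hm : ∀ i, IsRadon (m i)) {a : ℝ≥0∞} (ha : a < energy κ ν ν) :
    ∀ᶠ i in G, a < energy κ (m i) (m i) := by
  classical
  have := hν.1
  have := hν.2
  have hm1 := fun i => (hm i).1
  have hm2 := fun i => (hm i).2
  rw [energy_eq_iSup hκ] at ha
  obtain ⟨J, hJ⟩ := lt_iSup_iff.1 ha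
  obtain ⟨θ, hθ, hJ⟩ := exists_lt_one_lt_mul hJ
  have hs : ∀ᶠ i in G, ∀ S ∈ J.powerset,
      θ * ∫⁻ y, sideSup S y ∂ν ≤ ∫⁻ y, sideSup S y ∂(m i) := by
    refine (Filter.eventually_all_finset _).2 fun S _ => ?_
    rcases eq_or_ne (∫⁻ y, sideSup S y ∂ν) 0 with h0 | h0
    · simp [h0]
    · have : θ * ∫⁻ y, sideSup S y ∂ν < ∫⁻ y, sideSup S y ∂ν := by
        simpa using ENNReal.mul_lt_mul_left h0 (lintegral_sideSup_lt_top S ν).ne hθ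
      filter_upwards [h.eventually_lt_lintegral hm2 (lowerSemicontinuous_sideSup S) this] with i hi
      exact hi.le
  rw [← lintegral_const_mul' _ _ hθ.ne_top] at hJ
  have hl : LowerSemicontinuous fun x => θ * ∫⁻ y, boxSup J x y ∂ν := by
    refine (ENNReal.continuous_const_mul hθ.ne_top).comp_lowerSemicontinuous
      (lowerSemicontinuous_lintegral_boxSup J ν) fun a b h => ?_
    dsimp only
    gcongr
  filter_upwards [hs, h.eventually_lt_lintegral hm2 hl hJ] with i h1 h2
  refine h2.trans_le ?_
  rw [energy_eq_iSup hκ]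
  refine le_iSup_of_le J (lintegral_mono fun x => ?_)
  exact h1 _ (Finset.mem_powerset.2 (Finset.filter_subset _ _))

end Potential

section VagueCompactness

variable [SigmaCompactSpace X]

/-- Vague relative compactness of a family of measures that is bounded on compact sets. -/
theorem exists_vagueConv_of_bounded {ι : Type*} (G : Ultrafilter ι) (m : ι → Measure X)
    (hm : ∀ i, IsLocallyFiniteMeasure (m i))
    (hb : ∀ K, IsCompact K → ∃ C : ℝ≥0, ∀ i, m i K ≤ C) :
    ∃ ν : Measure X, IsRadon ν ∧ VagueConv (G : Filter ι) m ν := by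
  have hint (f : C_c(X, ℝ)) (i : ι) : Integrable f (m i) :=
    f.continuous.integrable_of_hasCompactSupport f.hasCompactSupport
  have hlim (f : C_c(X, ℝ)) : ∃ l : ℝ, Tendsto (fun i => ∫ x, f x ∂(m i)) G (𝓝 l) := by
    obtain ⟨C, hC⟩ := hb _ f.hasCompactSupport
    obtain ⟨B, hB⟩ := f.continuous.bounded_above_of_compact_support f.hasCompactSupport
    have hbd (i : ι) : ∫ x, f x ∂(m i) ∈ Icc (-(|B| * C)) (|B| * C) := by
      rw [mem_Icc, ← abs_le, ← Real.norm_eq_abs]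
      have h1 : ∫ x, f x ∂(m i) = ∫ x in tsupport f, f x ∂(m i) :=
        (setIntegral_tsupport).symm
      rw [h1]
      refine (norm_setIntegral_le_of_norm_le_const
        (f.hasCompactSupport.isCompact.measure_lt_top) (C := |B|)
        fun x _ => (hB x).trans (le_abs_self B)).trans ?_
      refine mul_le_mul_of_nonneg_left ?_ (abs_nonneg B)
      exact ENNReal.toReal_le_coe_of_le_coe (hC i)
    obtain ⟨l, -, hl⟩ := isCompact_Icc.ultrafilter_le_nhds
      (G.map fun i => ∫ x, f x ∂(m i)) (by
        rw [le_principal_iff]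
        exact Filter.mem_map.2 (Filter.univ_mem' hbd))
    exact ⟨l, hl⟩
  choose L hL using hlim
  let Λ : C_c(X, ℝ) →ₚ[ℝ] ℝ := PositiveLinearMap.mk₀
    { toFun := L
      map_add' := fun f g => by
        refine tendsto_nhds_unique (hL (f + g)) (((hL f).add (hL g)).congr fun i => ?_)
        simp [integral_add (hint f i) (hint g i)]
      map_smul' := fun c f => by
        refine tendsto_nhds_unique (hL (c • f)) (((hL f).const_mul c).congr fun i => ?_)
        simp [integral_const_mul] }
    (fun f hf => ge_of_tendsto' (hL f) fun i => integral_nonneg hf)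
  refine ⟨RealRMK.rieszMeasure Λ, ⟨inferInstance, inferInstance⟩, fun f hf hf' => ?_⟩
  have h := RealRMK.integral_rieszMeasure Λ ⟨⟨f, hf⟩, hf'⟩
  have h' := hL ⟨⟨f, hf⟩, hf'⟩
  exact h.symm ▸ h'

/-- A family of measures carried by a fixed compact set has vague limits, and no mass is lost. -/
theorem exists_vagueConv_of_compact {ι : Type*} (G : Ultrafilter ι) (m : ι → Measure X)
    (hm : ∀ i, IsLocallyFiniteMeasure (m i)) {L : Set X} (hL : IsCompact L)
    (hmL : ∀ i, m i Lᶜ = 0) {C : ℝ≥0} (hC : ∀ i, m i L ≤ C) {a : ℝ≥0} (ha : ∀ i, a ≤ m i L) :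
    ∃ ν : Measure X, IsRadon ν ∧ VagueConv (G : Filter ι) m ν ∧ a ≤ ν univ := by
  have hu (i : ι) (A : Set X) : m i A ≤ m i L := by
    calc m i A ≤ m i (L ∪ Lᶜ) := measure_mono (by simp)
      _ ≤ m i L + m i Lᶜ := measure_union_le _ _
      _ = m i L := by rw [hmL, add_zero]
  obtain ⟨ν, hν, h⟩ := exists_vagueConv_of_bounded G m hm fun K _ => ⟨C, fun i => (hu i K).trans (hC i)⟩
  refine ⟨ν, hν, h, ?_⟩
  obtain ⟨f, h1, -, h3, h4⟩ := exists_continuous_one_zero_of_isCompact hL isClosed_empty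
    (disjoint_empty L)
  have := hν.2
  have hle : (a : ℝ) ≤ ∫ x, f x ∂ν := by
    refine ge_of_tendsto' (h f f.continuous h3) fun i => ?_
    have := hm i
    calc (a : ℝ) ≤ (m i L).toReal :=
          ENNReal.toReal_mono ((hC i).trans_lt ENNReal.coe_lt_top).ne (ha i)
      _ = ∫ x in L, f x ∂(m i) := by
          rw [setIntegral_congr_fun hL.measurableSet h1]
          simp [Measure.real]
      _ ≤ ∫ x, f x ∂(m i) := setIntegral_le_integral
          (f.continuous.integrable_of_hasCompactSupport h3) (ae_of_all _ fun x => (h4 x).1)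
  calc (a : ℝ≥0∞) = ENNReal.ofReal a := by simp
    _ ≤ ENNReal.ofReal (∫ x, f x ∂ν) := ENNReal.ofReal_le_ofReal hle
    _ = ∫⁻ x, ENNReal.ofReal (f x) ∂ν := ofReal_integral_eq_lintegral_ofReal
          (f.continuous.integrable_of_hasCompactSupport h3) (ae_of_all _ fun x => (h4 x).1)
    _ ≤ ∫⁻ _, 1 ∂ν := lintegral_mono fun x => by simpa using (h4 x).2
    _ = ν univ := by simp

lemma IsRadon.zero : IsRadon (0 : Measure X) := ⟨inferInstance, inferInstance⟩

lemma IsRadon.add {μ ν : Measure X} (hμ : IsRadon μ) (hν : IsRadon ν) : IsRadon (μ + ν) := by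
  have := hμ.1
  have := hμ.2
  have := hν.1
  have := hν.2
  refine ⟨inferInstance, ⟨fun x => ?_⟩⟩
  obtain ⟨s, hs, hs'⟩ := μ.finiteAt_nhds x
  obtain ⟨t, ht, ht'⟩ := ν.finiteAt_nhds x
  refine ⟨s ∩ t, inter_mem hs ht, ?_⟩
  rw [Measure.add_apply]
  exact ENNReal.add_lt_top.2 ⟨(measure_mono inter_subset_left).trans_lt hs',
    (measure_mono inter_subset_right).trans_lt ht'⟩

lemma IsRadon.smul {μ : Measure X} (hμ : IsRadon μ) (c : ℝ≥0) : IsRadon (c • μ) := by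
  have := hμ.1
  have := hμ.2
  exact ⟨inferInstance, inferInstance⟩

lemma IsRadon.restrict {μ : Measure X} (hμ : IsRadon μ) (E : Set X) : IsRadon (μ.restrict E) := by
  have := hμ.1
  have := hμ.2
  have : IsLocallyFiniteMeasure (μ.restrict E) := inferInstance
  exact ⟨inferInstance, inferInstance⟩

end VagueCompactness

section EnergyForm

variable [SigmaCompactSpace X] {κ : X → X → ℝ≥0∞}

lemma energy_mono (κ : X → X → ℝ≥0∞) {μ μ' : Measure X} (h : μ ≤ μ') :
    energy κ μ μ ≤ energy κ μ' μ' := lintegral_mono' h fun _ => lintegral_mono' h le_rfl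

lemma energy_zero_left (κ : X → X → ℝ≥0∞) (ν : Measure X) : energy κ 0 ν = 0 := by
  simp [energy]

lemma energy_zero_right (κ : X → X → ℝ≥0∞) (ν : Measure X) : energy κ ν 0 = 0 := by
  simp [energy, pot]

lemma energy_add_left (κ : X → X → ℝ≥0∞) (μ μ' ν : Measure X) :
    energy κ (μ + μ') ν = energy κ μ ν + energy κ μ' ν := lintegral_add_measure _ _ _

lemma energy_smul_left (κ : X → X → ℝ≥0∞) (c : ℝ≥0) (μ ν : Measure X) :
    energy κ (c • μ) ν = c * energy κ μ ν := by
  simp only [energy]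
  rw [show c • μ = (c : ℝ≥0∞) • μ from rfl, lintegral_smul_measure, smul_eq_mul]

lemma energy_smul_right (κ : X → X → ℝ≥0∞) (c : ℝ≥0) (μ ν : Measure X) :
    energy κ μ (c • ν) = c * energy κ μ ν := by
  simp only [energy, pot]
  rw [← lintegral_const_mul' _ _ ENNReal.coe_ne_top]
  refine lintegral_congr fun x => ?_
  rw [show c • ν = (c : ℝ≥0∞) • ν from rfl, lintegral_smul_measure, smul_eq_mul]

lemma IsRadon.energy_comm (hκ : IsKernel κ) {μ ν : Measure X} (hμ : IsRadon μ) (hν : IsRadon ν) :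
    energy κ μ ν = energy κ ν μ := by
  have := hμ.1
  have := hμ.2
  have := hν.1
  have := hν.2
  exact Balayage.energy_comm hκ μ ν

lemma energy_lt_top (hE : EnergyPrinciple κ) {μ ν : Measure X} (hμ : μ ∈ Eplus κ)
    (hν : ν ∈ Eplus κ) : energy κ μ ν < ⊤ := by
  have h := (hE μ hμ ν hν).1
  have h2 : 2 * energy κ μ ν < ⊤ := h.trans_lt (ENNReal.add_lt_top.2 ⟨hμ.2, hν.2⟩)
  refine lt_of_le_of_lt ?_ h2
  rw [two_mul]
  exact le_self_add

lemma zero_mem_Eplus (κ : X → X → ℝ≥0∞) : (0 : Measure X) ∈ Eplus κ :=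
  ⟨IsRadon.zero, by simp [energy_zero_left]⟩

lemma restrict_mem_Eplus {μ : Measure X} (hμ : μ ∈ Eplus κ) (E : Set X) :
    μ.restrict E ∈ Eplus κ :=
  ⟨hμ.1.restrict E, (energy_mono κ Measure.restrict_le_self).trans_lt hμ.2⟩

lemma smul_mem_Eplus {μ : Measure X} (hμ : μ ∈ Eplus κ) (c : ℝ≥0) : c • μ ∈ Eplus κ := by
  refine ⟨hμ.1.smul c, ?_⟩
  rw [energy_smul_left, energy_smul_right]
  exact ENNReal.mul_lt_top ENNReal.coe_lt_top (ENNReal.mul_lt_top ENNReal.coe_lt_top hμ.2)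

lemma energy_add_right (hκ : IsKernel κ) {μ ν ν' : Measure X} (hμ : IsRadon μ) (hν : IsRadon ν)
    (hν' : IsRadon ν') : energy κ μ (ν + ν') = energy κ μ ν + energy κ μ ν' := by
  rw [hμ.energy_comm hκ (hν.add hν'), energy_add_left, hν.energy_comm hκ hμ,
    hν'.energy_comm hκ hμ]

lemma add_mem_Eplus (hκ : IsKernel κ) (hE : EnergyPrinciple κ) {μ ν : Measure X}
    (hμ : μ ∈ Eplus κ) (hν : ν ∈ Eplus κ) : μ + ν ∈ Eplus κ := by
  refine ⟨hμ.1.add hν.1, ?_⟩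
  rw [energy_add_left, energy_add_right hκ hμ.1 hμ.1 hν.1, energy_add_right hκ hν.1 hμ.1 hν.1]
  have := energy_lt_top hE hμ hν
  have := energy_lt_top hE hν hμ
  have := hμ.2
  have := hν.2
  simp [*]

/-- The mutual energy as a real number. -/
noncomputable def ip (κ : X → X → ℝ≥0∞) (μ ν : Measure X) : ℝ := (energy κ μ ν).toReal

lemma ip_nonneg (κ : X → X → ℝ≥0∞) (μ ν : Measure X) : 0 ≤ ip κ μ ν := ENNReal.toReal_nonneg

lemma ofReal_ip (hE : EnergyPrinciple κ) {μ ν : Measure X} (hμ : μ ∈ Eplus κ) (hν : ν ∈ Eplus κ) :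
    ENNReal.ofReal (ip κ μ ν) = energy κ μ ν := ENNReal.ofReal_toReal (energy_lt_top hE hμ hν).ne

lemma ip_comm (hκ : IsKernel κ) {μ ν : Measure X} (hμ : μ ∈ Eplus κ) (hν : ν ∈ Eplus κ) :
    ip κ μ ν = ip κ ν μ := by
  simp only [ip]
  rw [hμ.1.energy_comm hκ hν.1]

lemma ip_add_left (hE : EnergyPrinciple κ) {μ μ' ν : Measure X} (hμ : μ ∈ Eplus κ)
    (hμ' : μ' ∈ Eplus κ) (hν : ν ∈ Eplus κ) : ip κ (μ + μ') ν = ip κ μ ν + ip κ μ' ν := by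
  simp only [ip]
  rw [energy_add_left, ENNReal.toReal_add (energy_lt_top hE hμ hν).ne (energy_lt_top hE hμ' hν).ne]

lemma ip_add_right (hκ : IsKernel κ) (hE : EnergyPrinciple κ) {μ ν ν' : Measure X}
    (hμ : μ ∈ Eplus κ) (hν : ν ∈ Eplus κ) (hν' : ν' ∈ Eplus κ) :
    ip κ μ (ν + ν') = ip κ μ ν + ip κ μ ν' := by
  simp only [ip]
  rw [energy_add_right hκ hμ.1 hν.1 hν'.1,
    ENNReal.toReal_add (energy_lt_top hE hμ hν).ne (energy_lt_top hE hμ hν').ne]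

lemma ip_smul_left (κ : X → X → ℝ≥0∞) (c : ℝ≥0) (μ ν : Measure X) :
    ip κ (c • μ) ν = c * ip κ μ ν := by
  simp [ip, energy_smul_left]

lemma ip_smul_right (κ : X → X → ℝ≥0∞) (c : ℝ≥0) (μ ν : Measure X) :
    ip κ μ (c • ν) = c * ip κ μ ν := by
  simp [ip, energy_smul_right]

lemma ip_add_self (hκ : IsKernel κ) (hE : EnergyPrinciple κ) {μ ν : Measure X}
    (hμ : μ ∈ Eplus κ) (hν : ν ∈ Eplus κ) :
    ip κ (μ + ν) (μ + ν) = ip κ μ μ + 2 * ip κ μ ν + ip κ ν ν := by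
  rw [ip_add_left hE hμ hν (add_mem_Eplus hκ hE hμ hν), ip_add_right hκ hE hμ hμ hν,
    ip_add_right hκ hE hν hμ hν, ip_comm hκ hν hμ]
  ring

lemma two_mul_ip_le (hE : EnergyPrinciple κ) {μ ν : Measure X} (hμ : μ ∈ Eplus κ)
    (hν : ν ∈ Eplus κ) : 2 * ip κ μ ν ≤ ip κ μ μ + ip κ ν ν := by
  have h := ENNReal.toReal_mono (ENNReal.add_lt_top.2 ⟨hμ.2, hν.2⟩).ne (hE μ hμ ν hν).1
  rw [ENNReal.toReal_add hμ.2.ne hν.2.ne, ENNReal.toReal_mul] at h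
  simpa [ip] using h

lemma strDist_sq (hE : EnergyPrinciple κ) {μ ν : Measure X} (hμ : μ ∈ Eplus κ)
    (hν : ν ∈ Eplus κ) : strDist κ μ ν ^ 2 = ip κ μ μ - 2 * ip κ μ ν + ip κ ν ν := by
  have h := two_mul_ip_le hE hμ hν
  rw [strDist, Real.sq_sqrt]
  · rfl
  · simp only [ip] at h
    linarith

lemma strDist_nonneg (κ : X → X → ℝ≥0∞) (μ ν : Measure X) : 0 ≤ strDist κ μ ν :=
  Real.sqrt_nonneg _

lemma strDist_comm (hκ : IsKernel κ) {μ ν : Measure X} (hμ : μ ∈ Eplus κ) (hν : ν ∈ Eplus κ) :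
    strDist κ μ ν = strDist κ ν μ := by
  rw [strDist, strDist, hμ.1.energy_comm hκ hν.1]
  congr 1
  ring

/-- The Cauchy-Schwarz inequality against a difference of two measures. -/
theorem sq_ip_sub_ip_le (hκ : IsKernel κ) (hE : EnergyPrinciple κ) {μ α β : Measure X}
    (hμ : μ ∈ Eplus κ) (hα : α ∈ Eplus κ) (hβ : β ∈ Eplus κ) :
    (ip κ μ α - ip κ μ β) ^ 2 ≤ ip κ μ μ * strDist κ α β ^ 2 := by
  have aux {α β : Measure X} (hα : α ∈ Eplus κ) (hβ : β ∈ Eplus κ) (s : ℝ≥0) :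
      2 * s * (ip κ μ α - ip κ μ β) ≤ s ^ 2 * ip κ μ μ + strDist κ α β ^ 2 := by
    have hs := smul_mem_Eplus hμ s
    have h := two_mul_ip_le hE (add_mem_Eplus hκ hE hs hβ) hα
    rw [ip_add_self hκ hE hs hβ, ip_add_left hE hs hβ hα, ip_smul_left, ip_smul_left,
      ip_smul_left, ip_smul_right] at h
    rw [strDist_sq hE hα hβ, ip_comm hκ hα hβ]
    nlinarith
  have key (s : ℝ) : 0 ≤ ip κ μ μ * (s * s) + -(2 * (ip κ μ α - ip κ μ β)) * s
      + strDist κ α β ^ 2 := by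
    rcases le_total 0 s with hs | hs
    · have := aux hα hβ s.toNNReal
      rw [Real.coe_toNNReal s hs] at this
      nlinarith
    · have := aux hβ hα (-s).toNNReal
      rw [Real.coe_toNNReal (-s) (by linarith), strDist_comm hκ hβ hα] at this
      nlinarith
  have := discrim_le_zero key
  rw [discrim] at this
  nlinarith

theorem ip_sq_le (hκ : IsKernel κ) (hE : EnergyPrinciple κ) {μ ν : Measure X}
    (hμ : μ ∈ Eplus κ) (hν : ν ∈ Eplus κ) : ip κ μ ν ^ 2 ≤ ip κ μ μ * ip κ ν ν := by
  have h := sq_ip_sub_ip_le hκ hE hμ hν (zero_mem_Eplus κ)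
  rw [strDist_sq hE hν (zero_mem_Eplus κ)] at h
  simpa [ip, energy_zero_left, energy_zero_right] using h

lemma eq_zero_of_energy_eq_zero (hE : EnergyPrinciple κ) {μ : Measure X} (hμ : μ ∈ Eplus κ)
    (h : energy κ μ μ = 0) : μ = 0 :=
  (hE μ hμ 0 (zero_mem_Eplus κ)).2 (by simp [h, energy_zero_right])

end EnergyForm

section Capacity

variable [SigmaCompactSpace X] {κ : X → X → ℝ≥0∞}

/-- The supremum of the masses that measures of energy at most one put on `A`; on measurable sets
this is the square root of the inner capacity. -/
noncomputable def cap (κ : X → X → ℝ≥0∞) (A : Set X) : ℝ≥0∞ :=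
  ⨆ μ ∈ {μ ∈ Eplus κ | energy κ μ μ ≤ 1}, μ A

/-- The outer regularization of `cap`. -/
noncomputable def ocap (κ : X → X → ℝ≥0∞) (A : Set X) : ℝ≥0∞ :=
  ⨅ D ∈ {D : Set X | IsOpen D ∧ A ⊆ D}, cap κ D

lemma le_cap {μ : Measure X} (hμ : μ ∈ Eplus κ) (h : energy κ μ μ ≤ 1) (A : Set X) :
    μ A ≤ cap κ A :=
  le_biSup (fun μ : Measure X => μ A) (show μ ∈ {μ ∈ Eplus κ | energy κ μ μ ≤ 1} from ⟨hμ, h⟩)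

lemma cap_le {A : Set X} {a : ℝ≥0∞} (h : ∀ μ ∈ Eplus κ, energy κ μ μ ≤ 1 → μ A ≤ a) :
    cap κ A ≤ a := iSup₂_le fun _ hμ => h _ hμ.1 hμ.2

lemma exists_lt_of_lt_cap {A : Set X} {a : ℝ≥0∞} (h : a < cap κ A) :
    ∃ μ ∈ Eplus κ, energy κ μ μ ≤ 1 ∧ a < μ A := by
  obtain ⟨μ, hμ⟩ := lt_iSup_iff.1 h
  obtain ⟨h1, h2⟩ := lt_iSup_iff.1 hμ
  exact ⟨μ, h1.1, h1.2, h2⟩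

lemma cap_mono {A B : Set X} (h : A ⊆ B) : cap κ A ≤ cap κ B :=
  iSup₂_mono fun _ _ => measure_mono h

lemma cap_iUnion_le {ι : Type*} [Countable ι] (A : ι → Set X) :
    cap κ (⋃ i, A i) ≤ ∑' i, cap κ (A i) :=
  cap_le fun _ hμ h => (measure_iUnion_le A).trans (ENNReal.tsum_le_tsum fun i => le_cap hμ h (A i))

lemma cap_le_ocap (A : Set X) : cap κ A ≤ ocap κ A := le_iInf₂ fun _ hD => cap_mono hD.2

lemma ocap_le_cap {A D : Set X} (hD : IsOpen D) (h : A ⊆ D) : ocap κ A ≤ cap κ D :=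
  iInf₂_le (f := fun D _ => cap κ D) D ⟨hD, h⟩

lemma ocap_mono {A B : Set X} (h : A ⊆ B) : ocap κ A ≤ ocap κ B :=
  le_iInf₂ fun _ hD => ocap_le_cap hD.1 (h.trans hD.2)

lemma exists_isOpen_of_ocap_lt {A : Set X} {a : ℝ≥0∞} (h : ocap κ A < a) :
    ∃ D, IsOpen D ∧ A ⊆ D ∧ cap κ D < a := by
  obtain ⟨D, hD⟩ := iInf_lt_iff.1 h
  obtain ⟨h1, h2⟩ := iInf_lt_iff.1 hD
  exact ⟨D, h1.1, h1.2, h2⟩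

lemma ocap_iUnion_le (A : ℕ → Set X) : ocap κ (⋃ i, A i) ≤ ∑' i, ocap κ (A i) := by
  by_cases hfin : ∑' i, ocap κ (A i) = ⊤
  · simp [hfin]
  refine ENNReal.le_of_forall_pos_le_add fun ε hε _ => ?_
  obtain ⟨δ, hδ, hsum⟩ := ENNReal.exists_pos_sum_of_countable (ε := ε) (by simpa using hε.ne') ℕ
  have hlt (i : ℕ) : ocap κ (A i) < ocap κ (A i) + δ i :=
    ENNReal.lt_add_right (ENNReal.ne_top_of_tsum_ne_top hfin i) (by simpa using (hδ i).ne')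
  choose D hD hAD hc using fun i => exists_isOpen_of_ocap_lt (hlt i)
  calc ocap κ (⋃ i, A i) ≤ cap κ (⋃ i, D i) :=
        ocap_le_cap (isOpen_iUnion hD) (iUnion_mono hAD)
    _ ≤ ∑' i, cap κ (D i) := cap_iUnion_le D
    _ ≤ ∑' i, (ocap κ (A i) + δ i) := ENNReal.tsum_le_tsum fun i => (hc i).le
    _ = ∑' i, ocap κ (A i) + ∑' i, (δ i : ℝ≥0∞) := ENNReal.tsum_add
    _ ≤ ∑' i, ocap κ (A i) + ε := by gcongr

lemma cap_union_le (A B : Set X) : cap κ (A ∪ B) ≤ cap κ A + cap κ B :=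
  cap_le fun _ hμ h => (measure_union_le A B).trans (add_le_add (le_cap hμ h A) (le_cap hμ h B))

lemma ocap_union_le (A B : Set X) : ocap κ (A ∪ B) ≤ ocap κ A + ocap κ B := by
  by_cases hA : ocap κ A = ⊤
  · simp [hA]
  by_cases hB : ocap κ B = ⊤
  · simp [hB]
  refine ENNReal.le_of_forall_pos_le_add fun ε hε _ => ?_
  have hε2 : (ε / 2 : ℝ≥0∞) ≠ 0 := by simpa using hε.ne'
  obtain ⟨D, hD, hAD, hc⟩ := exists_isOpen_of_ocap_lt (ENNReal.lt_add_right hA hε2)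
  obtain ⟨D', hD', hAD', hc'⟩ := exists_isOpen_of_ocap_lt (ENNReal.lt_add_right hB hε2)
  calc ocap κ (A ∪ B) ≤ cap κ (D ∪ D') :=
        ocap_le_cap (hD.union hD') (union_subset_union hAD hAD')
    _ ≤ cap κ D + cap κ D' := cap_union_le _ _
    _ ≤ (ocap κ A + ε / 2) + (ocap κ B + ε / 2) := add_le_add hc.le hc'.le
    _ = ocap κ A + ocap κ B + (ε / 2 + ε / 2) := by ring
    _ = ocap κ A + ocap κ B + ε := by rw [ENNReal.add_halves]

lemma measure_le_mul_cap {μ : Measure X} (hμ : μ ∈ Eplus κ) {r : ℝ≥0} (hr : r ≠ 0)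
    (h : energy κ μ μ ≤ r ^ 2) (A : Set X) : μ A ≤ r * cap κ A := by
  have hr' : (r : ℝ≥0∞) ≠ 0 := by simpa using hr
  have h1 : energy κ (r⁻¹ • μ) (r⁻¹ • μ) ≤ 1 := by
    rw [energy_smul_left, energy_smul_right, ENNReal.coe_inv hr]
    calc (r : ℝ≥0∞)⁻¹ * ((r : ℝ≥0∞)⁻¹ * energy κ μ μ)
        ≤ (r : ℝ≥0∞)⁻¹ * ((r : ℝ≥0∞)⁻¹ * (r : ℝ≥0∞) ^ 2) := by gcongr
      _ = 1 := by
        rw [sq, ENNReal.inv_mul_cancel_left hr' ENNReal.coe_ne_top,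
          ENNReal.inv_mul_cancel hr' ENNReal.coe_ne_top]
  have h2 := le_cap (smul_mem_Eplus hμ r⁻¹) h1 A
  rw [Measure.smul_apply, ENNReal.smul_def, smul_eq_mul, ENNReal.coe_inv hr] at h2
  calc μ A = r * ((r : ℝ≥0∞)⁻¹ * μ A) := by
        rw [ENNReal.mul_inv_cancel_left hr' ENNReal.coe_ne_top]
    _ ≤ r * cap κ A := by gcongr

lemma measure_le_sqrt_mul_cap (hE : EnergyPrinciple κ) {μ : Measure X} (hμ : μ ∈ Eplus κ)
    (A : Set X) : μ A ≤ ENNReal.ofReal (√(ip κ μ μ)) * cap κ A := by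
  rcases (ip_nonneg κ μ μ).eq_or_lt with h | h
  · have : μ = 0 := eq_zero_of_energy_eq_zero hE hμ (by
      rw [← ofReal_ip hE hμ hμ, ← h, ENNReal.ofReal_zero])
    simp [this]
  · refine measure_le_mul_cap hμ (r := (√(ip κ μ μ)).toNNReal) ?_ ?_ A
    · simpa using h
    · change _ ≤ ENNReal.ofReal (√(ip κ μ μ)) ^ 2
      rw [← ENNReal.ofReal_pow (Real.sqrt_nonneg _), Real.sq_sqrt h.le, ofReal_ip hE hμ hμ]

lemma measure_ne_top_of_cap_ne_top (hE : EnergyPrinciple κ) {μ : Measure X} (hμ : μ ∈ Eplus κ)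
    {A : Set X} (hA : cap κ A ≠ ⊤) : μ A ≠ ⊤ :=
  ((measure_le_sqrt_mul_cap hE hμ A).trans_lt (ENNReal.mul_lt_top ENNReal.ofReal_lt_top
    hA.lt_top)).ne

lemma sq_measureReal_le (hE : EnergyPrinciple κ) {μ : Measure X} (hμ : μ ∈ Eplus κ)
    {A : Set X} (hA : cap κ A ≠ ⊤) : μ.real A ^ 2 ≤ (cap κ A).toReal ^ 2 * ip κ μ μ := by
  have h := ENNReal.toReal_mono (ENNReal.mul_lt_top ENNReal.ofReal_lt_top hA.lt_top).ne
    (measure_le_sqrt_mul_cap hE hμ A)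
  rw [ENNReal.toReal_mul, ENNReal.toReal_ofReal (Real.sqrt_nonneg _)] at h
  calc μ.real A ^ 2 ≤ (√(ip κ μ μ) * (cap κ A).toReal) ^ 2 := by
        gcongr
        exact h
    _ = _ := by rw [mul_pow, Real.sq_sqrt (ip_nonneg κ μ μ), mul_comm]

lemma cap_le_of_le_energy (hκ : IsKernel κ) (hE : EnergyPrinciple κ) {γ : Measure X}
    (hγ : γ ∈ Eplus κ) {A : Set X} (h : ∀ ν ∈ Eplus κ, ν A ≤ energy κ ν γ) :
    cap κ A ≤ ENNReal.ofReal (√(ip κ γ γ)) := by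
  refine cap_le fun μ hμ h1 => (h μ hμ).trans ?_
  rw [← ofReal_ip hE hμ hγ]
  refine ENNReal.ofReal_le_ofReal (Real.le_sqrt_of_sq_le ((ip_sq_le hκ hE hμ hγ).trans ?_))
  refine mul_le_of_le_one_left (ip_nonneg κ γ γ) ?_
  exact ENNReal.toReal_le_of_le_ofReal zero_le_one (by simpa using h1)

/-- Compact sets have finite capacity, as a measure of zero energy vanishes. -/
theorem cap_lt_top_of_isCompact (hκ : IsKernel κ) (hE : EnergyPrinciple κ) {L : Set X}
    (hL : IsCompact L) : cap κ L < ⊤ := by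
  by_contra hcon
  have htop : cap κ L = ⊤ := by simpa using hcon
  have hex (n : ℕ) : ∃ μ ∈ Eplus κ, energy κ μ μ ≤ 1 ∧ (n + 1 : ℝ≥0∞) < μ L :=
    exists_lt_of_lt_cap (by rw [htop]; exact ENNReal.add_lt_top.2 ⟨by simp, by simp⟩)
  choose μ hμ hμ1 hμL using hex
  have hfin (n : ℕ) : μ n L ≠ ⊤ := by
    have := (hμ n).1.2
    exact hL.measure_lt_top.ne
  have hne (n : ℕ) : μ n L ≠ 0 := (hμL n).ne_bot
  let c (n : ℕ) : ℝ≥0 := (μ n L).toNNReal⁻¹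
  have hc (n : ℕ) : (c n : ℝ≥0∞) = (μ n L)⁻¹ := by
    rw [ENNReal.coe_inv (ENNReal.toNNReal_ne_zero.2 ⟨hne n, hfin n⟩), ENNReal.coe_toNNReal (hfin n)]
  let m (n : ℕ) : Measure X := c n • (μ n).restrict L
  have hm (n : ℕ) : m n ∈ Eplus κ := smul_mem_Eplus (restrict_mem_Eplus (hμ n) L) _
  have hmL (n : ℕ) : m n L = 1 := by
    rw [Measure.smul_apply, Measure.restrict_apply_self, ENNReal.smul_def, smul_eq_mul, hc,
      ENNReal.inv_mul_cancel (hne n) (hfin n)]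
  have hmc (n : ℕ) : m n Lᶜ = 0 := by
    rw [Measure.smul_apply, Measure.restrict_apply hL.measurableSet.compl]
    simp
  have hme (n : ℕ) : energy κ (m n) (m n) ≤ (n + 1 : ℝ≥0∞)⁻¹ := by
    rw [energy_smul_left, energy_smul_right, hc]
    have h1 : (μ n L)⁻¹ ≤ (n + 1 : ℝ≥0∞)⁻¹ := ENNReal.inv_le_inv.2 (hμL n).le
    have h2 : (μ n L)⁻¹ ≤ 1 := by
      rw [ENNReal.inv_le_one]
      exact le_trans (by simp) (hμL n).le
    calc (μ n L)⁻¹ * ((μ n L)⁻¹ * energy κ ((μ n).restrict L) ((μ n).restrict L))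
        ≤ (n + 1 : ℝ≥0∞)⁻¹ * (1 * 1) := by
          gcongr
          exact (energy_mono κ Measure.restrict_le_self).trans (hμ1 n)
      _ = _ := by simp
  obtain ⟨ν, hν, hvc, hν1⟩ := exists_vagueConv_of_compact (hyperfilter ℕ) m (fun n => (hm n).1.2) hL
    hmc (C := 1) (a := 1) (fun n => by simp [hmL n]) (fun n => by simp [hmL n])
  have hνe : energy κ ν ν = 0 := by
    by_contra hne0
    obtain ⟨N, hN⟩ := ENNReal.exists_inv_nat_lt hne0
    have h1 := hvc.eventually_lt_energy hκ.lsc hν (fun n => (hm n).1) hN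
    have h2 : ∀ᶠ n in (hyperfilter ℕ : Filter ℕ), N ≤ n :=
      Nat.hyperfilter_le_atTop (eventually_ge_atTop N)
    obtain ⟨n, hn1, hn2⟩ := (h1.and h2).exists
    refine absurd (hn1.trans_le (hme n)) (not_lt.2 (ENNReal.inv_le_inv.2 ?_))
    exact_mod_cast hn2.trans (Nat.le_succ n)
  have h0 := eq_zero_of_energy_eq_zero hE ⟨hν, by simp [hνe]⟩ hνe
  rw [h0] at hν1
  simp at hν1

/-- The cone of measures of finite energy is strongly complete for sequences. -/
theorem StrongCauchy.exists_limit (hκ : IsKernel κ) (hE : EnergyPrinciple κ) (hC : Consistent κ)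
    {m : ℕ → Measure X} (hm : ∀ n, m n ∈ Eplus κ) {C : ℝ≥0} (hb : ∀ n, energy κ (m n) (m n) ≤ C)
    (hcau : StrongCauchy κ atTop m) :
    ∃ ν ∈ Eplus κ, Tendsto (fun n => strDist κ (m n) ν) atTop (𝓝 0) ∧
      ∀ a : ℝ≥0∞, (∀ᶠ n in atTop, energy κ (m n) (m n) ≤ a) → energy κ ν ν ≤ a := by
  have hcomp (K : Set X) (hK : IsCompact K) : ∃ c : ℝ≥0, ∀ n, m n K ≤ c := by
    have hcap := cap_lt_top_of_isCompact hκ hE hK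
    lift cap κ K to ℝ≥0 using hcap.ne with b hbK
    refine ⟨(C + 1) * b, fun n => ?_⟩
    have := measure_le_mul_cap (hm n) (r := C + 1) (by positivity) ((hb n).trans ?_) K
    · rw [← hbK] at this
      exact_mod_cast this
    · norm_cast
      nlinarith [(zero_le : 0 ≤ C)]
  obtain ⟨ν, hν, hvc⟩ := exists_vagueConv_of_bounded (hyperfilter ℕ) m (fun n => (hm n).1.2) hcomp
  have hlim (a : ℝ≥0∞) (ha : ∀ᶠ n in atTop, energy κ (m n) (m n) ≤ a) : energy κ ν ν ≤ a := by
    by_contra! hlt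
    have h1 := hvc.eventually_lt_energy hκ.lsc hν (fun n => (hm n).1) hlt
    obtain ⟨n, hn1, hn2⟩ := (h1.and (Nat.hyperfilter_le_atTop ha)).exists
    exact absurd hn1 (not_lt.2 hn2)
  refine ⟨ν, ⟨hν, (hlim C (Eventually.of_forall hb)).trans_lt ENNReal.coe_lt_top⟩, ?_, hlim⟩
  exact hC ℕ atTop m inferInstance hm hcau ν
    ⟨hyperfilter ℕ, Nat.hyperfilter_le_atTop, inferInstance, hvc⟩

end Capacity

section Extremal

variable [SigmaCompactSpace X] {κ : X → X → ℝ≥0∞}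

lemma strDist_sq_eq_parallelogram (hκ : IsKernel κ) (hE : EnergyPrinciple κ) {μ ν : Measure X}
    (hμ : μ ∈ Eplus κ) (hν : ν ∈ Eplus κ) :
    strDist κ μ ν ^ 2 = 2 * ip κ μ μ + 2 * ip κ ν ν - ip κ (μ + ν) (μ + ν) := by
  rw [strDist_sq hE hμ hν, ip_add_self hκ hE hμ hν]
  ring

lemma strongCauchy_of_sq_le (hκ : IsKernel κ) {m : ℕ → Measure X}
    (hm : ∀ n, m n ∈ Eplus κ) {f : ℕ → ℝ} (hf : Tendsto f atTop (𝓝 0))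
    (h : ∀ k n, k ≤ n → strDist κ (m k) (m n) ^ 2 ≤ f k + f n) : StrongCauchy κ atTop m := by
  intro ε hε
  have hev : ∀ᶠ n in atTop, f n < ε ^ 2 / 2 := hf.eventually_lt_const (by positivity)
  refine ⟨_, hev, ?_⟩
  have key (i j : ℕ) (hij : i ≤ j) (hi : f i < ε ^ 2 / 2) (hj : f j < ε ^ 2 / 2) :
      strDist κ (m i) (m j) < ε :=
    lt_of_pow_lt_pow_left₀ 2 hε.le ((h i j hij).trans_lt (by linarith))
  intro i hi j hj
  rcases le_total i j with hij | hij
  · exact key i j hij hi hj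
  · rw [strDist_comm hκ (hm i) (hm j)]
    exact key j i hij hj hi

lemma tendsto_ip (hκ : IsKernel κ) (hE : EnergyPrinciple κ) {m : ℕ → Measure X}
    (hm : ∀ n, m n ∈ Eplus κ) {μ ν : Measure X} (hμ : μ ∈ Eplus κ) (hν : ν ∈ Eplus κ)
    (h : Tendsto (fun n => strDist κ (m n) μ) atTop (𝓝 0)) :
    Tendsto (fun n => ip κ ν (m n)) atTop (𝓝 (ip κ ν μ)) := by
  rw [tendsto_iff_norm_sub_tendsto_zero]
  have h2 : Tendsto (fun n => √(ip κ ν ν) * strDist κ (m n) μ) atTop (𝓝 0) := by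
    simpa using h.const_mul (√(ip κ ν ν))
  refine squeeze_zero (fun _ => norm_nonneg _) (fun n => ?_) h2
  rw [Real.norm_eq_abs]
  refine abs_le_of_sq_le_sq ?_ (mul_nonneg (Real.sqrt_nonneg _) (strDist_nonneg _ _ _))
  rw [mul_pow, Real.sq_sqrt (ip_nonneg κ ν ν)]
  exact sq_ip_sub_ip_le hκ hE hν (hm n) hμ

/-- The equilibrium measure: a set of finite capacity carries a measure whose energy is the
squared capacity and whose potential is at least one in the weak sense. -/
theorem exists_equilibrium (hκ : IsKernel κ) (hE : EnergyPrinciple κ) (hC : Consistent κ)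
    {E : Set X} (hfin : cap κ E ≠ ⊤) :
    ∃ γ ∈ Eplus κ, ip κ γ γ ≤ (cap κ E).toReal ^ 2 ∧ ∀ ν ∈ Eplus κ, ν E ≤ energy κ ν γ := by
  rcases eq_or_ne (cap κ E) 0 with h0 | h0
  · refine ⟨0, zero_mem_Eplus κ, by simp [ip, energy_zero_right, h0], fun ν hν => ?_⟩
    have h := measure_le_sqrt_mul_cap hE hν E
    rw [h0, mul_zero] at h
    exact h.trans bot_le
  set q := (cap κ E).toReal with hq
  have hqpos : 0 < q := ENNReal.toReal_pos h0 hfin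
  have hex (n : ℕ) : ∃ μ ∈ Eplus κ, energy κ μ μ ≤ 1 ∧ ENNReal.ofReal (q - 1 / (n + 1)) < μ E := by
    refine exists_lt_of_lt_cap ?_
    rw [← ENNReal.ofReal_toReal hfin, ENNReal.ofReal_lt_ofReal_iff hqpos]
    exact sub_lt_self _ (by positivity)
  choose μ hμ hμ1 hμE using hex
  have hip1 (n : ℕ) : ip κ (μ n) (μ n) ≤ 1 :=
    ENNReal.toReal_le_of_le_ofReal zero_le_one (by simpa using hμ1 n)
  have hupper (n : ℕ) : (μ n).real E ≤ q := ENNReal.toReal_mono hfin (le_cap (hμ n) (hμ1 n) E)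
  have hlower (n : ℕ) : q - 1 / (n + 1) ≤ (μ n).real E :=
    (ENNReal.ofReal_le_iff_le_toReal (measure_ne_top_of_cap_ne_top hE (hμ n) hfin)).1 (hμE n).le
  have ha : Tendsto (fun n => (μ n).real E) atTop (𝓝 q) := by
    refine tendsto_of_tendsto_of_tendsto_of_le_of_le ?_ tendsto_const_nhds hlower hupper
    simpa using tendsto_one_div_add_atTop_nhds_zero_nat.const_sub q
  have hsum {α β : Measure X} (hα : α ∈ Eplus κ) (hβ : β ∈ Eplus κ) :
      (α.real E + β.real E) ^ 2 ≤ q ^ 2 * ip κ (α + β) (α + β) := by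
    have h := sq_measureReal_le hE (add_mem_Eplus hκ hE hα hβ) hfin
    rwa [measureReal_add_apply (measure_ne_top_of_cap_ne_top hE hα hfin)
      (measure_ne_top_of_cap_ne_top hE hβ hfin)] at h
  have hcau : StrongCauchy κ atTop μ := by
    refine strongCauchy_of_sq_le hκ hμ (f := fun n => 4 * (q - (μ n).real E) / q) ?_ ?_
    · simpa using ((ha.const_sub q).const_mul 4).div_const q
    · intro k n _
      rw [strDist_sq_eq_parallelogram hκ hE (hμ k) (hμ n), ← add_div, le_div_iff₀ hqpos]
      have h1 := hsum (hμ k) (hμ n)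
      have h2 := hip1 k
      have h3 := hip1 n
      have h4 := sq_nonneg ((μ k).real E + (μ n).real E - 2 * q)
      refine le_of_mul_le_mul_left ?_ hqpos
      nlinarith [mul_le_mul_of_nonneg_left h2 (sq_nonneg q),
        mul_le_mul_of_nonneg_left h3 (sq_nonneg q)]
  obtain ⟨lim, hlim, hconv, hlime⟩ := hcau.exists_limit hκ hE hC hμ (C := 1) (by simpa using hμ1)
  have hlim1 : ip κ lim lim ≤ 1 := ENNReal.toReal_le_of_le_ofReal zero_le_one
    (by simpa using hlime 1 (Eventually.of_forall hμ1))
  refine ⟨q.toNNReal • lim, smul_mem_Eplus hlim _, ?_, fun ν hν => ?_⟩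
  · rw [ip_smul_left, ip_smul_right, Real.coe_toNNReal q hqpos.le]
    nlinarith
  have hineq (t : ℝ≥0) : (q + t * ν.real E) ^ 2 ≤
      q ^ 2 * (1 + 2 * t * ip κ ν lim + t ^ 2 * ip κ ν ν) := by
    have ht := smul_mem_Eplus hν t
    refine le_of_tendsto_of_tendsto' ((ha.add_const (t * ν.real E)).pow 2)
      ((((((tendsto_ip hκ hE hμ hlim hν hconv).const_mul (2 * (t : ℝ))).const_add 1).add_const
        (t ^ 2 * ip κ ν ν))).const_mul (q ^ 2)) fun n => ?_
    have h := hsum (hμ n) ht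
    rw [ip_add_self hκ hE (hμ n) ht, ip_smul_right, ip_smul_right, ip_smul_left,
      ip_comm hκ (hμ n) hν] at h
    have h1 : (t • ν).real E = t * ν.real E := by simp [measureReal_def]
    rw [h1] at h
    nlinarith [hip1 n, mul_le_mul_of_nonneg_left (hip1 n) (sq_nonneg q)]
  have hmain : ν.real E ≤ q * ip κ ν lim := by
    refine le_of_forall_pos_le_add fun ε hε => ?_
    have hN := ip_nonneg κ ν ν
    obtain ⟨t, ht0, ht⟩ : ∃ t : ℝ≥0, 0 < t ∧ q * t * ip κ ν ν ≤ 2 * ε := by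
      refine ⟨(2 * ε / (q * (ip κ ν ν + 1))).toNNReal, ?_, ?_⟩
      · rw [Real.toNNReal_pos]
        positivity
      · rw [Real.coe_toNNReal _ (by positivity)]
        have : q * (2 * ε / (q * (ip κ ν ν + 1))) * ip κ ν ν
            = 2 * ε * (ip κ ν ν / (ip κ ν ν + 1)) := by
          field_simp
        rw [this]
        refine mul_le_of_le_one_right (by positivity) ?_
        rw [div_le_one (by positivity)]
        linarith
    have h := hineq t
    have ht0' : (0 : ℝ) < t := ht0
    have hqt : 0 < 2 * q * t := by positivity
    refine le_of_mul_le_mul_left ?_ hqt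
    nlinarith [mul_le_mul_of_nonneg_left ht (mul_pos hqpos ht0').le,
      sq_nonneg (t * ν.real E)]
  rw [energy_smul_right, ← ofReal_ip hE hν hlim]
  change _ ≤ ENNReal.ofReal q * _
  rw [← ENNReal.ofReal_mul hqpos.le]
  exact (ENNReal.le_ofReal_iff_toReal_le (measure_ne_top_of_cap_ne_top hE hν hfin)
    (mul_nonneg hqpos.le (ip_nonneg _ _ _))).2 hmain

/-- The weak type estimate for the capacity of superlevel sets of a potential. -/
theorem mul_cap_lt_pot_le (hκ : IsKernel κ) (hE : EnergyPrinciple κ) {γ : Measure X}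
    (hγ : γ ∈ Eplus κ) {t : ℝ≥0} (ht : t ≠ 0) :
    t * cap κ {x | (t : ℝ≥0∞) < pot κ γ x} ≤ ENNReal.ofReal (√(ip κ γ γ)) := by
  have ht' : (t : ℝ≥0∞) ≠ 0 := by simpa using ht
  have := hγ.1.1
  have h := cap_le_of_le_energy hκ hE (smul_mem_Eplus hγ t⁻¹)
    (A := {x | (t : ℝ≥0∞) < pot κ γ x}) fun ν hν => by
      rw [energy_smul_right, ENNReal.coe_inv ht, ← ENNReal.div_eq_inv_mul]
      refine (measure_mono (t := {x | (t : ℝ≥0∞) ≤ pot κ γ x}) ?_).trans (meas_ge_le_lintegral_div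
        (lowerSemicontinuous_pot hκ.lsc γ).measurable.aemeasurable ht' ENNReal.coe_ne_top)
      exact fun x (hx : (t : ℝ≥0∞) < pot κ γ x) => hx.le
  rw [ip_smul_left, ip_smul_right, ← mul_assoc, ← sq, Real.sqrt_mul (by positivity),
    Real.sqrt_sq (by positivity), ENNReal.ofReal_mul (by positivity), ENNReal.ofReal_coe_nnreal,
    ENNReal.coe_inv ht] at h
  calc t * cap κ {x | (t : ℝ≥0∞) < pot κ γ x} ≤ t * ((t : ℝ≥0∞)⁻¹ * _) := by gcongr
    _ = _ := ENNReal.mul_inv_cancel_left ht' ENNReal.coe_ne_top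

end Extremal

section Continuity

variable [SigmaCompactSpace X] {κ : X → X → ℝ≥0∞}

/-- Compact sets are capacitable. -/
theorem ocap_eq_cap_of_isCompact [NormalSpace X]
    (hPN : ∀ F : Set X, IsClosed F → ∃ U : ℕ → Set X, (∀ n, IsOpen (U n)) ∧ F = ⋂ n, U n)
    (hκ : IsKernel κ) (hE : EnergyPrinciple κ) {K : Set X} (hK : IsCompact K) :
    ocap κ K = cap κ K := by
  refine le_antisymm ?_ (cap_le_ocap K)
  by_contra! hlt
  obtain ⟨a, ha1, ha2⟩ := exists_between hlt
  lift a to ℝ≥0 using ha2.ne_top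
  obtain ⟨U, hU, hKU⟩ := hPN K hK.isClosed
  obtain ⟨L, hL, hKL⟩ := exists_compact_superset hK
  have hT (n : ℕ) : ∃ T, IsOpen T ∧ K ⊆ T ∧ closure T ⊆ U n :=
    normal_exists_closure_subset hK.isClosed (hU n) (hKU.trans_subset (iInter_subset U n))
  choose T hTo hKT hTU using hT
  let V (n : ℕ) : Set X := interior L ∩ ⋂ k ∈ Iic n, T k
  have hV (n : ℕ) : IsOpen (V n) :=
    isOpen_interior.inter ((finite_Iic n).isOpen_biInter fun k _ => hTo k)
  have hKV (n : ℕ) : K ⊆ V n := subset_inter hKL (subset_iInter₂ fun k _ => hKT k)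
  have hVL (n : ℕ) : V n ⊆ L := inter_subset_left.trans interior_subset
  have hVT (k n : ℕ) (h : k ≤ n) : V n ⊆ T k :=
    inter_subset_right.trans (biInter_subset_of_mem (mem_Iic.2 h))
  choose μ hμ hμ1 hμV using fun n =>
    exists_lt_of_lt_cap (ha2.trans_le (ocap_le_cap (hV n) (hKV n)))
  let m (n : ℕ) : Measure X := (μ n).restrict (V n)
  have hm (n : ℕ) : m n ∈ Eplus κ := restrict_mem_Eplus (hμ n) _
  have hm1 (n : ℕ) : energy κ (m n) (m n) ≤ 1 :=
    (energy_mono κ Measure.restrict_le_self).trans (hμ1 n)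
  have hmout (n : ℕ) {s : Set X} (hs : MeasurableSet s) (h : V n ⊆ sᶜ) : m n s = 0 := by
    rw [Measure.restrict_apply hs, (subset_compl_iff_disjoint_left.1 h).inter_eq, measure_empty]
  have hcap := cap_lt_top_of_isCompact hκ hE hL
  lift cap κ L to ℝ≥0 using hcap.ne with C hCL
  obtain ⟨ν, hν, hvc, haν⟩ := exists_vagueConv_of_compact (hyperfilter ℕ) m (fun n => (hm n).1.2) hL
    (fun n => hmout n hL.measurableSet.compl (by simpa using hVL n)) (C := C) (a := a)
    (fun n => hCL ▸ le_cap (hm n) (hm1 n) L)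
    (fun n => (hμV n).le.trans_eq (Measure.restrict_apply_superset (hVL n)).symm)
  have hν1 : energy κ ν ν ≤ 1 := by
    by_contra! h
    obtain ⟨n, hn⟩ := (hvc.eventually_lt_energy hκ.lsc hν (fun n => (hm n).1) h).exists
    exact absurd hn (not_lt.2 (hm1 n))
  have hνE : ν ∈ Eplus κ := ⟨hν, hν1.trans_lt ENNReal.one_lt_top⟩
  have hzero (k : ℕ) : ν (closure (T k))ᶜ = 0 := by
    by_contra h
    have ho : IsOpen (closure (T k))ᶜ := isClosed_closure.isOpen_compl
    have := hν.1
    have := hν.2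
    have hev := hvc.eventually_lt_lintegral (fun n => (hm n).1.2)
      (ho.lowerSemicontinuous_indicator (y := (1 : ℝ≥0∞)) zero_le) (a := 0) (by
        rw [lintegral_indicator_const ho.measurableSet, one_mul]
        exact pos_iff_ne_zero.2 h)
    obtain ⟨n, hn1, hn2⟩ := (hev.and (Nat.hyperfilter_le_atTop (eventually_ge_atTop k))).exists
    rw [lintegral_indicator_const ho.measurableSet, one_mul, hmout n ho.measurableSet] at hn1
    · exact lt_irrefl _ hn1
    · rw [compl_compl]
      exact (hVT k n hn2).trans subset_closure
  have hKc : ν Kᶜ = 0 := by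
    refine measure_mono_null ?_ (measure_iUnion_null hzero)
    rw [← compl_iInter, compl_subset_compl]
    exact (iInter_mono hTU).trans hKU.symm.subset
  refine absurd (haν.trans ?_) (not_le.2 ha1)
  calc ν univ ≤ ν K + ν Kᶜ := by rw [← union_compl_self K]; exact measure_union_le _ _
    _ ≤ cap κ K := by
      rw [hKc, add_zero]
      exact le_cap hνE hν1 K

lemma le_of_forall_lt_one_mul_le {a b : ℝ≥0∞} (h : ∀ t : ℝ≥0, t ≠ 0 → t < 1 → t * a ≤ b) :
    a ≤ b := by
  by_contra! hlt
  obtain ⟨θ, h1, h2⟩ := exists_lt_one_lt_mul hlt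
  lift θ to ℝ≥0 using h1.ne_top
  refine absurd h2 (not_lt.2 (h θ ?_ (by exact_mod_cast h1)))
  rintro rfl
  simp at h2

lemma setLIntegral_pot_le {γ ν : Measure X} {N : Set X} {t : ℝ≥0} (hN : MeasurableSet N)
    (h : ∀ x ∈ N, pot κ γ x ≤ t) : energy κ (ν.restrict N) γ ≤ t * ν N := by
  rw [← setLIntegral_const]
  exact setLIntegral_mono' hN h

/-- Countable unions of compact sets are capacitable. -/
theorem ocap_iUnion_le_cap_of_isCompact [NormalSpace X]
    (hPN : ∀ F : Set X, IsClosed F → ∃ U : ℕ → Set X, (∀ n, IsOpen (U n)) ∧ F = ⋂ n, U n)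
    (hκ : IsKernel κ) (hE : EnergyPrinciple κ) (hC : Consistent κ) {K : ℕ → Set X}
    (hK : ∀ j, IsCompact (K j)) : ocap κ (⋃ j, K j) ≤ cap κ (⋃ j, K j) := by
  by_cases hfin : cap κ (⋃ j, K j) = ⊤
  · simp [hfin]
  obtain ⟨γ, hγ, hγE, hγν⟩ := exists_equilibrium hκ hE hC hfin
  have := hγ.1.1
  have hlsc := lowerSemicontinuous_pot hκ.lsc γ
  refine le_of_forall_lt_one_mul_le fun t ht0 ht1 => ?_
  have hD : IsOpen {x | (t : ℝ≥0∞) < pot κ γ x} := hlsc.isOpen_preimage t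
  let N (j : ℕ) : Set X := K j ∩ {x | (t : ℝ≥0∞) < pot κ γ x}ᶜ
  have hN (j : ℕ) : IsCompact (N j) := (hK j).inter_right hD.isClosed_compl
  have hN0 (j : ℕ) : ocap κ (N j) = 0 := by
    rw [ocap_eq_cap_of_isCompact hPN hκ hE (hN j)]
    refine nonpos_iff_eq_zero.1 (cap_le fun ν hν _ => ?_)
    have := hν.1.2
    have h1 : ν (N j) ≤ t * ν (N j) := by
      calc ν (N j) = ν.restrict (N j) (⋃ j, K j) :=
          (Measure.restrict_apply_superset
            (inter_subset_left.trans (subset_iUnion K j))).symm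
        _ ≤ energy κ (ν.restrict (N j)) γ := hγν _ (restrict_mem_Eplus hν _)
        _ ≤ t * ν (N j) := setLIntegral_pot_le (hN j).measurableSet fun x hx => not_lt.1 hx.2
    by_contra! h0
    have h2 : t * ν (N j) < 1 * ν (N j) :=
      ENNReal.mul_lt_mul_left h0.ne' (hN j).measure_lt_top.ne (by exact_mod_cast ht1)
    rw [one_mul] at h2
    exact absurd h1 (not_le.2 h2)
  have hcover : (⋃ j, K j) ⊆ {x | (t : ℝ≥0∞) < pot κ γ x} ∪ ⋃ j, N j := by
    intro x hx
    obtain ⟨j, hj⟩ := mem_iUnion.1 hx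
    by_cases h : (t : ℝ≥0∞) < pot κ γ x
    · exact Or.inl h
    · exact Or.inr (mem_iUnion.2 ⟨j, hj, h⟩)
  calc t * ocap κ (⋃ j, K j)
      ≤ t * (ocap κ {x | (t : ℝ≥0∞) < pot κ γ x} + ocap κ (⋃ j, N j)) := by
        gcongr
        exact (ocap_mono hcover).trans (ocap_union_le _ _)
    _ ≤ t * (cap κ {x | (t : ℝ≥0∞) < pot κ γ x} + 0) := by
        gcongr
        · exact ocap_le_cap hD subset_rfl
        · exact (ocap_iUnion_le N).trans (by simp [hN0])
    _ ≤ ENNReal.ofReal (√(ip κ γ γ)) := by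
        rw [add_zero]
        exact mul_cap_lt_pot_le hκ hE hγ ht0
    _ ≤ ENNReal.ofReal (cap κ (⋃ j, K j)).toReal :=
        ENNReal.ofReal_le_ofReal (Real.sqrt_le_iff.2 ⟨ENNReal.toReal_nonneg, hγE⟩)
    _ = cap κ (⋃ j, K j) := ENNReal.ofReal_toReal hfin

lemma exists_isCompact_iUnion_eq_inter
    (hPN : ∀ F : Set X, IsClosed F → ∃ U : ℕ → Set X, (∀ n, IsOpen (U n)) ∧ F = ⋂ n, U n)
    {D F : Set X} (hD : IsOpen D) (hF : IsClosed F) :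
    ∃ K : ℕ → Set X, (∀ j, IsCompact (K j)) ∧ D ∩ F = ⋃ j, K j := by
  obtain ⟨U, hU, hDU⟩ := hPN Dᶜ hD.isClosed_compl
  refine ⟨fun j => compactCovering X j.unpair.2 ∩ ((U j.unpair.1)ᶜ ∩ F),
    fun j => (isCompact_compactCovering X _).inter_right ((hU _).isClosed_compl.inter hF), ?_⟩
  have hDU' : D = ⋃ n, (U n)ᶜ := by rw [← compl_iInter, ← hDU, compl_compl]
  rw [iUnion_unpair fun i j => compactCovering X j ∩ ((U i)ᶜ ∩ F)]
  simp_rw [← iUnion_inter, iUnion_compactCovering, univ_inter]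
  rw [← iUnion_inter, ← hDU']

end Continuity

section Sequential

variable [SigmaCompactSpace X] {κ : X → X → ℝ≥0∞}

/-- A measure in the unit ball can put only little mass on the set where the potential of an
equilibrium measure exceeds that of a strongly close measure. -/
lemma cap_inter_compl_le (hκ : IsKernel κ) (hE : EnergyPrinciple κ) {D : Set X}
    (hD : MeasurableSet D) (hfin : cap κ D ≠ ⊤) {α γ : Measure X} (hα : α ∈ Eplus κ)
    (hγ : γ ∈ Eplus κ) (hαD : ∀ ν ∈ Eplus κ, ν D ≤ energy κ ν α) {t : ℝ≥0} (ht : t < 1) :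
    cap κ (D ∩ {x | (t : ℝ≥0∞) < pot κ γ x}ᶜ) ≤
      ENNReal.ofReal (strDist κ α γ / (1 - t)) := by
  have ht' : (0 : ℝ) < 1 - t := sub_pos.2 (by exact_mod_cast ht)
  have := hγ.1.1
  have hlsc := lowerSemicontinuous_pot hκ.lsc γ
  have hO : IsOpen {x | (t : ℝ≥0∞) < pot κ γ x} := hlsc.isOpen_preimage t
  set N := D ∩ {x | (t : ℝ≥0∞) < pot κ γ x}ᶜ with hNdef
  have hN : MeasurableSet N := hD.inter hO.measurableSet.compl
  refine cap_le fun ν hν hν1 => ?_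
  have hνN := restrict_mem_Eplus hν N
  have hνfin : ν N ≠ ⊤ :=
    measure_ne_top_of_cap_ne_top hE hν ((cap_mono inter_subset_left).trans_lt hfin.lt_top).ne
  have h1 : ν.real N ≤ ip κ (ν.restrict N) α := by
    refine ENNReal.toReal_mono (energy_lt_top hE hνN hα).ne ?_
    rw [← Measure.restrict_apply_superset (μ := ν) (inter_subset_left : N ⊆ D)]
    exact hαD _ hνN
  have h2 : ip κ (ν.restrict N) γ ≤ t * ν.real N := by
    have h := ENNReal.toReal_mono (ENNReal.mul_lt_top ENNReal.coe_lt_top hνfin.lt_top).ne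
      (setLIntegral_pot_le (κ := κ) (γ := γ) (ν := ν) (t := t) hN fun x hx => not_lt.1 hx.2)
    rwa [ENNReal.toReal_mul, ENNReal.coe_toReal] at h
  have h3 : ip κ (ν.restrict N) (ν.restrict N) ≤ 1 :=
    ENNReal.toReal_le_of_le_ofReal zero_le_one
      (by simpa using (energy_mono κ Measure.restrict_le_self).trans hν1)
  have h4 : ip κ (ν.restrict N) α - ip κ (ν.restrict N) γ ≤ strDist κ α γ := by
    refine le_of_abs_le (abs_le_of_sq_le_sq ?_ (strDist_nonneg κ α γ))
    exact (sq_ip_sub_ip_le hκ hE hνN hα hγ).trans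
      (mul_le_of_le_one_left (sq_nonneg _) h3)
  rw [ENNReal.le_ofReal_iff_toReal_le hνfin (div_nonneg (strDist_nonneg _ _ _) ht'.le),
    le_div_iff₀ ht']
  change ν.real N * _ ≤ _
  linarith

/-- The outer capacity is continuous along increasing sequences of arbitrary sets. -/
theorem ocap_iUnion_le_iSup [NormalSpace X]
    (hPN : ∀ F : Set X, IsClosed F → ∃ U : ℕ → Set X, (∀ n, IsOpen (U n)) ∧ F = ⋂ n, U n)
    (hκ : IsKernel κ) (hE : EnergyPrinciple κ) (hC : Consistent κ) {A : ℕ → Set X}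
    (hA : Monotone A) : ocap κ (⋃ n, A n) ≤ ⨆ n, ocap κ (A n) := by
  by_cases hS : ⨆ n, ocap κ (A n) = ⊤
  · simp [hS]
  have hle (n : ℕ) : ocap κ (A n) ≤ ⨆ n, ocap κ (A n) := le_iSup (fun n => ocap κ (A n)) n
  have hAfin (n : ℕ) : ocap κ (A n) ≠ ⊤ := ((hle n).trans_lt (lt_top_iff_ne_top.2 hS)).ne
  set s := (⨆ n, ocap κ (A n)).toReal with hs
  have hs0 : 0 ≤ s := ENNReal.toReal_nonneg
  set r : ℕ → ℝ := fun n => (ocap κ (A n)).toReal with hr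
  have hr0 (n : ℕ) : 0 ≤ r n := ENNReal.toReal_nonneg
  have hrs (n : ℕ) : r n ≤ s := ENNReal.toReal_mono hS (hle n)
  have hrlim : Tendsto r atTop (𝓝 s) :=
    (ENNReal.tendsto_toReal hS).comp (tendsto_atTop_iSup fun _ _ h => ocap_mono (hA h))
  set e : ℕ → ℝ := fun n => 1 / ((n : ℝ) + 1) with he
  have he0 (n : ℕ) : 0 < e n := by positivity
  have hanti : Antitone e := fun a b h => one_div_le_one_div_of_le (by positivity) (by gcongr)
  have helim : Tendsto e atTop (𝓝 0) := tendsto_one_div_add_atTop_nhds_zero_nat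
  have hex (n : ℕ) : ocap κ (A n) < ENNReal.ofReal (r n + e n) := by
    rw [← ENNReal.ofReal_toReal (hAfin n),
      ENNReal.ofReal_lt_ofReal_iff (add_pos_of_nonneg_of_pos (hr0 n) (he0 n))]
    exact lt_add_of_pos_right _ (he0 n)
  choose D hD hAD hDc using fun n => exists_isOpen_of_ocap_lt (hex n)
  have hDfin (n : ℕ) : cap κ (D n) ≠ ⊤ := (hDc n).ne_top
  choose γ hγ hγE hγD using fun n => exists_equilibrium hκ hE hC (hDfin n)
  have hγr (n : ℕ) : ip κ (γ n) (γ n) ≤ (r n + e n) ^ 2 := by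
    refine (hγE n).trans ?_
    have := ENNReal.toReal_le_of_le_ofReal (add_pos_of_nonneg_of_pos (hr0 n) (he0 n)).le (hDc n).le
    gcongr
  have hγs (k n : ℕ) (h : k ≤ n) : energy κ (γ n) (γ n) ≤ ENNReal.ofReal ((s + e k) ^ 2) := by
    rw [← ofReal_ip hE (hγ n) (hγ n)]
    refine ENNReal.ofReal_le_ofReal ((hγr n).trans ?_)
    have := hanti h
    have := hrs n
    have := hr0 n
    have := he0 n
    gcongr
  have hmid (k n : ℕ) (h : k ≤ n) : 4 * r k ^ 2 ≤ ip κ (γ k + γ n) (γ k + γ n) := by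
    have hadd := add_mem_Eplus hκ hE (hγ k) (hγ n)
    have h1 := cap_le_of_le_energy hκ hE (smul_mem_Eplus hadd 2⁻¹) (A := D k ∩ D n) fun ν hν => by
      rw [energy_smul_right, energy_add_right hκ hν.1 (hγ k).1 (hγ n).1, ENNReal.coe_inv two_ne_zero,
        ENNReal.coe_ofNat, ← ENNReal.div_eq_inv_mul, ENNReal.le_div_iff_mul_le (by simp) (by simp),
        mul_two]
      exact add_le_add ((measure_mono inter_subset_left).trans (hγD k ν hν))
        ((measure_mono inter_subset_right).trans (hγD n ν hν))
    have h2 : r k ≤ √(ip κ ((2⁻¹ : ℝ≥0) • (γ k + γ n)) ((2⁻¹ : ℝ≥0) • (γ k + γ n))) :=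
      ENNReal.toReal_le_of_le_ofReal (Real.sqrt_nonneg _) ((ocap_le_cap ((hD k).inter (hD n))
        (subset_inter (hAD k) ((hA h).trans (hAD n)))).trans h1)
    rw [ip_smul_left, ip_smul_right, Real.le_sqrt (hr0 k)] at h2
    · push_cast at h2
      linarith
    · have := ip_nonneg κ (γ k + γ n) (γ k + γ n)
      positivity
  have hcau : StrongCauchy κ atTop γ := by
    refine strongCauchy_of_sq_le hκ hγ (f := fun n => 4 * (s + e n) ^ 2 - 4 * r n ^ 2) ?_ ?_
    · simpa using (((helim.const_add s).pow 2).const_mul 4).sub ((hrlim.pow 2).const_mul 4)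
    · intro k n h
      rw [strDist_sq_eq_parallelogram hκ hE (hγ k) (hγ n)]
      have h1 := hmid k n h
      have h2 := (hγr k).trans (pow_le_pow_left₀ (by linarith [hr0 k, he0 k])
        (add_le_add_left (hrs k) (e k)) 2)
      have h3 := (hγr n).trans (pow_le_pow_left₀ (by linarith [hr0 n, he0 n])
        (add_le_add_left (hrs n) (e n)) 2)
      have h4 : r n ^ 2 ≤ (s + e n) ^ 2 := pow_le_pow_left₀ (hr0 n) (by linarith [hrs n, he0 n]) 2
      have h5 : r n ^ 2 ≤ (s + e k) ^ 2 := pow_le_pow_left₀ (hr0 n) (by linarith [hrs n, he0 k]) 2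
      linarith
  obtain ⟨lim, hlim, hconv, hlime⟩ := hcau.exists_limit hκ hE hC hγ (C := ((s + 1) ^ 2).toNNReal)
    fun n => (hγs 0 n (zero_le)).trans (ENNReal.ofReal_le_ofReal (by simp [he]))
  have hlims : ip κ lim lim ≤ s ^ 2 := by
    have h : Tendsto (fun k => (s + e k) ^ 2) atTop (𝓝 (s ^ 2)) := by
      simpa using (helim.const_add s).pow 2
    refine ge_of_tendsto' h fun k => ENNReal.toReal_le_of_le_ofReal (sq_nonneg _) ?_
    exact hlime _ ((eventually_ge_atTop k).mono fun n hn => hγs k n hn)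
  have := hlim.1.1
  have hlsc := lowerSemicontinuous_pot hκ.lsc lim
  refine le_of_forall_lt_one_mul_le fun t ht0 ht1 => ?_
  have ht' : (0 : ℝ) < 1 - t := sub_pos.2 (by exact_mod_cast ht1)
  have hO : IsOpen {x | (t : ℝ≥0∞) < pot κ lim x} := hlsc.isOpen_preimage t
  let N (n : ℕ) : Set X := D n ∩ {x | (t : ℝ≥0∞) < pot κ lim x}ᶜ
  have hN (n : ℕ) : ocap κ (N n) ≤ ENNReal.ofReal (strDist κ (γ n) lim / (1 - t)) := by
    obtain ⟨K, hK, hNK⟩ := exists_isCompact_iUnion_eq_inter hPN (hD n) hO.isClosed_compl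
    refine le_trans ?_ (cap_inter_compl_le hκ hE (hD n).measurableSet (hDfin n) (hγ n) hlim
      (hγD n) ht1)
    change ocap κ (D n ∩ _) ≤ _
    rw [hNK]
    exact ocap_iUnion_le_cap_of_isCompact hPN hκ hE hC hK
  have hNlim : Tendsto (fun n => ENNReal.ofReal (strDist κ (γ n) lim / (1 - t))) atTop (𝓝 0) := by
    simpa using ENNReal.tendsto_ofReal (hconv.div_const (1 - (t : ℝ)))
  refine ENNReal.le_of_forall_pos_le_add fun ε hε _ => ?_
  obtain ⟨δ, hδ, hsum⟩ := ENNReal.exists_pos_sum_of_countable (ε := ε) (by simpa using hε.ne') ℕ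
  have hsel (k : ℕ) : ∃ n, k ≤ n ∧ ocap κ (N n) ≤ δ k := by
    have hev := hNlim.eventually_lt_const (show (0 : ℝ≥0∞) < δ k by exact_mod_cast hδ k)
    obtain ⟨n, h1, h2⟩ := (hev.and (eventually_ge_atTop k)).exists
    exact ⟨n, h2, (hN n).trans h1.le⟩
  choose n hkn hnδ using hsel
  have hcover : (⋃ k, A k) ⊆ {x | (t : ℝ≥0∞) < pot κ lim x} ∪ ⋃ k, N (n k) := by
    intro x hx
    obtain ⟨k, hk⟩ := mem_iUnion.1 hx
    by_cases h : (t : ℝ≥0∞) < pot κ lim x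
    · exact Or.inl h
    · exact Or.inr (mem_iUnion.2 ⟨k, hAD (n k) (hA (hkn k) hk), h⟩)
  calc t * ocap κ (⋃ k, A k)
      ≤ t * (ocap κ {x | (t : ℝ≥0∞) < pot κ lim x} + ocap κ (⋃ k, N (n k))) := by
        gcongr
        exact (ocap_mono hcover).trans (ocap_union_le _ _)
    _ ≤ t * (cap κ {x | (t : ℝ≥0∞) < pot κ lim x} + ε) := by
        gcongr
        · exact ocap_le_cap hO subset_rfl
        · exact ((ocap_iUnion_le _).trans (ENNReal.tsum_le_tsum hnδ)).trans hsum.le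
    _ = t * cap κ {x | (t : ℝ≥0∞) < pot κ lim x} + t * ε := mul_add _ _ _
    _ ≤ ENNReal.ofReal (√(ip κ lim lim)) + 1 * ε := by
        gcongr
        · exact mul_cap_lt_pot_le hκ hE hlim ht0
        · exact_mod_cast ht1.le
    _ ≤ ENNReal.ofReal s + ε := by
        rw [one_mul]
        gcongr
        exact Real.sqrt_le_iff.2 ⟨hs0, hlims⟩
    _ = (⨆ n, ocap κ (A n)) + ε := by rw [hs, ENNReal.ofReal_toReal hS]

end Sequential

section Souslin

/-- `B` is the projection of a closed subset of `X × ℕ^ℕ`. -/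
def IsSouslin (B : Set X) : Prop := ∃ C : Set (X × (ℕ → ℕ)), IsClosed C ∧ B = Prod.fst '' C

lemma isSouslin_of_isClosed {F : Set X} (hF : IsClosed F) : IsSouslin F :=
  ⟨F ×ˢ univ, hF.prod isClosed_univ, (fst_image_prod F univ_nonempty).symm⟩

lemma IsSouslin.iUnion {B : ℕ → Set X} (hB : ∀ n, IsSouslin (B n)) : IsSouslin (⋃ n, B n) := by
  choose C hC hBC using hB
  refine ⟨⋂ n, {p | p.2 0 ≠ n ∨ (p.1, fun i => p.2 (i + 1)) ∈ C n}, isClosed_iInter fun n => ?_, ?_⟩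
  · refine IsClosed.union ?_ ((hC n).preimage (by fun_prop))
    exact (isClosed_discrete {n}ᶜ).preimage (f := fun p : X × (ℕ → ℕ) => p.2 0) (by fun_prop)
  · ext x
    simp only [hBC, mem_iUnion, mem_image, Prod.exists, exists_and_right, exists_eq_right,
      mem_iInter, mem_ofPred_eq]
    constructor
    · rintro ⟨n, s, hs⟩
      refine ⟨fun i => Nat.casesOn i n s, fun k => ?_⟩
      rcases eq_or_ne n k with rfl | h
      · exact Or.inr hs
      · exact Or.inl h
    · rintro ⟨s, hs⟩
      exact ⟨s 0, _, (hs (s 0)).resolve_left (by simp)⟩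

lemma IsSouslin.iInter {B : ℕ → Set X} (hB : ∀ n, IsSouslin (B n)) : IsSouslin (⋂ n, B n) := by
  choose C hC hBC using hB
  refine ⟨⋂ n, {p | (p.1, fun i => p.2 (Nat.pair n i)) ∈ C n},
    isClosed_iInter fun n => (hC n).preimage (by fun_prop), ?_⟩
  ext x
  simp only [hBC, mem_image, Prod.exists, exists_and_right, exists_eq_right, mem_iInter,
    mem_ofPred_eq]
  constructor
  · intro h
    choose s hs using h
    exact ⟨fun j => s j.unpair.1 j.unpair.2, fun n => by simpa using hs n⟩
  · rintro ⟨s, hs⟩ n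
    exact ⟨_, hs n⟩

lemma isSouslin_of_measurableSet
    (hPN : ∀ F : Set X, IsClosed F → ∃ U : ℕ → Set X, (∀ n, IsOpen (U n)) ∧ F = ⋂ n, U n)
    {B : Set X} (hB : MeasurableSet B) : IsSouslin B := by
  suffices IsSouslin B ∧ IsSouslin Bᶜ from this.1
  induction B, hB using MeasurableSet.induction_on_open with
  | isOpen U hU =>
    refine ⟨?_, isSouslin_of_isClosed hU.isClosed_compl⟩
    obtain ⟨V, hV, hUV⟩ := hPN Uᶜ hU.isClosed_compl
    rw [← compl_compl U, hUV, compl_iInter]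
    exact IsSouslin.iUnion fun n => isSouslin_of_isClosed (hV n).isClosed_compl
  | compl t _ ih => exact ⟨ih.2, by rw [compl_compl]; exact ih.1⟩
  | iUnion f _ _ ih =>
    refine ⟨IsSouslin.iUnion fun i => (ih i).1, ?_⟩
    rw [compl_iUnion]
    exact IsSouslin.iInter fun i => (ih i).2

variable [SigmaCompactSpace X] {κ : X → X → ℝ≥0∞}

/-- Choquet's theorem: Souslin sets are inner approximable by compact sets. -/
theorem IsSouslin.exists_isCompact_le_ocap [NormalSpace X]
    (hPN : ∀ F : Set X, IsClosed F → ∃ U : ℕ → Set X, (∀ n, IsOpen (U n)) ∧ F = ⋂ n, U n)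
    (hκ : IsKernel κ) (hE : EnergyPrinciple κ) (hC : Consistent κ) {B : Set X}
    (hB : IsSouslin B) {a : ℝ≥0∞} (ha : a < ocap κ B) :
    ∃ K ⊆ B, IsCompact K ∧ a ≤ ocap κ K := by
  obtain ⟨C, hCc, rfl⟩ := hB
  have hsplit {G : Set (X × (ℕ → ℕ))} (hG : a < ocap κ (Prod.fst '' G))
      {S : ℕ → Set (X × (ℕ → ℕ))} (hS : Monotone S) (hSu : ⋃ n, S n = univ) :
      ∃ n, a < ocap κ (Prod.fst '' (G ∩ S n)) := by
    rw [← inter_univ G, ← hSu, inter_iUnion, image_iUnion] at hG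
    exact lt_iSup_iff.1 (hG.trans_le (ocap_iUnion_le_iSup hPN hκ hE hC
      fun _ _ h => image_mono (inter_subset_inter_right G (hS h))))
  obtain ⟨N, hN⟩ := hsplit ha (S := fun n => Prod.fst ⁻¹' compactCovering X n)
    (fun _ _ h => preimage_mono (compactCovering_subset X h))
    (by rw [← preimage_iUnion, iUnion_compactCovering, preimage_univ])
  have hstep (k : ℕ) (G : {G : Set (X × (ℕ → ℕ)) // a < ocap κ (Prod.fst '' G)}) :
      ∃ n : ℕ, a < ocap κ (Prod.fst '' (G.1 ∩ {p | p.2 k ≤ n})) :=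
    hsplit G.2 (fun _ _ h p (hp : _ ≤ _) => hp.trans h)
      (eq_univ_of_forall fun p => mem_iUnion.2 ⟨p.2 k, le_refl (p.2 k)⟩)
  choose b hb using hstep
  let G (k : ℕ) : {G : Set (X × (ℕ → ℕ)) // a < ocap κ (Prod.fst '' G)} :=
    Nat.rec ⟨_, hN⟩ (fun k G => ⟨_, hb k G⟩) k
  let m (k : ℕ) : ℕ := b k (G k)
  have hG (k : ℕ) : ∀ p ∈ (G k).1, p ∈ C ∧ p.1 ∈ compactCovering X N ∧ ∀ i < k, p.2 i ≤ m i := by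
    induction k with
    | zero => exact fun p hp => ⟨hp.1, hp.2, by simp⟩
    | succ k ih =>
      intro p hp
      obtain ⟨h1, h2, h3⟩ := ih p hp.1
      refine ⟨h1, h2, fun i hi => ?_⟩
      rcases (Nat.lt_succ_iff_lt_or_eq.1 hi) with h | rfl
      · exact h3 i h
      · exact hp.2
  have hcomp (M : ℕ → ℕ) : IsCompact (compactCovering X N ×ˢ univ.pi fun i => Iic (M i)) :=
    (isCompact_compactCovering X N).prod
      (isCompact_univ_pi fun i => (finite_Iic (M i)).isCompact)
  refine ⟨Prod.fst '' (C ∩ (compactCovering X N ×ˢ univ.pi fun i => Iic (m i))),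
    image_mono inter_subset_left, ((hcomp m).inter_left hCc).image continuous_fst, ?_⟩
  refine le_iInf₂ fun D hD => ?_
  obtain ⟨k, hk⟩ : ∃ k, Prod.fst '' (G k).1 ⊆ D := by
    by_contra! hcon
    have hex (k : ℕ) : ∃ p ∈ (G k).1, p.1 ∉ D := by
      obtain ⟨_, ⟨p, hp, rfl⟩, hpD⟩ := not_subset.1 (hcon k)
      exact ⟨p, hp, hpD⟩
    choose p hp hpD using hex
    let M (i : ℕ) : ℕ := (Finset.range (i + 1)).sup (fun k => (p k).2 i) ⊔ m i
    have hpM (k : ℕ) : p k ∈ compactCovering X N ×ˢ univ.pi fun i => Iic (M i) := by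
      refine ⟨(hG k _ (hp k)).2.1, fun i _ => ?_⟩
      rcases lt_or_ge i k with h | h
      · exact ((hG k _ (hp k)).2.2 i h).trans le_sup_right
      · exact (Finset.le_sup (f := fun k => (p k).2 i)
          (Finset.mem_range.2 (Nat.lt_succ_of_le h))).trans le_sup_left
    obtain ⟨z, hz, hlim⟩ := (hcomp M).ultrafilter_le_nhds' ((hyperfilter ℕ).map p)
      (Ultrafilter.mem_map.2 (univ_mem' hpM))
    have hlim' : Tendsto p (hyperfilter ℕ) (𝓝 z) := hlim
    have hzC : z ∈ C := hCc.mem_of_tendsto hlim' (Eventually.of_forall fun k => (hG k _ (hp k)).1)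
    have hzD : z.1 ∉ D := hD.1.isClosed_compl.mem_of_tendsto
      ((continuous_fst.tendsto z).comp hlim') (Eventually.of_forall hpD)
    have hzm (i : ℕ) : z.2 i ≤ m i := by
      have ht : Tendsto (fun k => (p k).2 i) (hyperfilter ℕ) (𝓝 (z.2 i)) :=
        (((continuous_apply i).comp continuous_snd).tendsto z).comp hlim'
      refine le_of_tendsto ht (Nat.hyperfilter_le_atTop ?_)
      filter_upwards [eventually_gt_atTop i] with k hk
      exact (hG k _ (hp k)).2.2 i hk
    exact hzD (hD.2 ⟨z, ⟨hzC, hz.1, fun i _ => hzm i⟩, rfl⟩)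
  exact (G k).2.le.trans (ocap_le_cap hD.1 hk)

/-- Borel sets are capacitable for `cap`. -/
theorem ocap_eq_cap_of_measurableSet [NormalSpace X]
    (hPN : ∀ F : Set X, IsClosed F → ∃ U : ℕ → Set X, (∀ n, IsOpen (U n)) ∧ F = ⋂ n, U n)
    (hκ : IsKernel κ) (hE : EnergyPrinciple κ) (hC : Consistent κ) {B : Set X}
    (hB : MeasurableSet B) : ocap κ B = cap κ B := by
  refine le_antisymm (le_of_forall_lt_imp_le_of_dense fun a ha => ?_) (cap_le_ocap B)
  obtain ⟨K, hKB, hK, haK⟩ :=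
    (isSouslin_of_measurableSet hPN hB).exists_isCompact_le_ocap hPN hκ hE hC ha
  rw [ocap_eq_cap_of_isCompact hPN hκ hE hK] at haK
  exact haK.trans (cap_mono hKB)

end Souslin

section InnerCapacity

variable [SigmaCompactSpace X] {κ : X → X → ℝ≥0∞}

lemma ConcOn.measure_compl_eq_zero {μ : Measure X} {A : Set X} (h : ConcOn μ A) : μ Aᶜ = 0 := by
  rw [← inter_univ Aᶜ, ← iUnion_compactCovering X, inter_iUnion]
  exact measure_iUnion_null fun n => h.2 _ (isCompact_compactCovering X n)

lemma inv_energy_le_innerCap {μ : Measure X} {A : Set X} (hμ : μ ∈ EplusOn κ A)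
    (h1 : μ univ = 1) : (energy κ μ μ)⁻¹ ≤ innerCap κ A :=
  ENNReal.inv_le_inv.2 (iInf₂_le (f := fun μ _ => energy κ μ μ) μ ⟨hμ, h1⟩)

lemma innerCap_le_sq_cap (hE : EnergyPrinciple κ) (A : Set X) : innerCap κ A ≤ cap κ A ^ 2 := by
  rw [innerCap, ENNReal.inv_le_iff_inv_le]
  refine le_iInf₂ fun μ hμ => ?_
  have hμE := hμ.1.1
  have h1 : 1 ≤ μ A := by
    rw [← hμ.2, ← union_compl_self A]
    exact (measure_union_le _ _).trans_eq (by rw [hμ.1.2.measure_compl_eq_zero, add_zero])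
  have h2 : 1 ≤ energy κ μ μ * cap κ A ^ 2 := by
    calc (1 : ℝ≥0∞) = 1 ^ 2 := by simp
      _ ≤ (ENNReal.ofReal (√(ip κ μ μ)) * cap κ A) ^ 2 := by
        gcongr
        exact h1.trans (measure_le_sqrt_mul_cap hE hμE A)
      _ = energy κ μ μ * cap κ A ^ 2 := by
        rw [mul_pow, ← ENNReal.ofReal_pow (Real.sqrt_nonneg _), Real.sq_sqrt (ip_nonneg κ μ μ),
          ofReal_ip hE hμE hμE]
  rw [← one_div]
  exact ENNReal.div_le_of_le_mul h2

lemma sq_measure_le_innerCap {μ : Measure X} (hμ : μ ∈ Eplus κ) (h1 : energy κ μ μ ≤ 1)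
    {A K : Set X} (hA : MeasurableSet A) (hK : IsCompact K) (hKA : K ⊆ A) :
    μ K ^ 2 ≤ innerCap κ A := by
  rcases eq_or_ne (μ K) 0 with h0 | h0
  · simp [h0]
  have hlf := hμ.1.2
  have hfin : μ K ≠ ⊤ := hK.measure_lt_top.ne
  set c : ℝ≥0 := (μ K).toNNReal⁻¹ with hcdef
  have hc : (c : ℝ≥0∞) = (μ K)⁻¹ := by
    rw [hcdef, ENNReal.coe_inv (ENNReal.toNNReal_ne_zero.2 ⟨h0, hfin⟩), ENNReal.coe_toNNReal hfin]
  have hmem : c • μ.restrict K ∈ EplusOn κ A := by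
    refine ⟨smul_mem_Eplus (restrict_mem_Eplus hμ K) c, hA.nullMeasurableSet, fun L hL => ?_⟩
    rw [Measure.smul_apply, Measure.restrict_apply (hA.compl.inter hL.measurableSet)]
    have : Aᶜ ∩ L ∩ K = ∅ := by
      ext x
      simp only [mem_inter_iff, mem_compl_iff, mem_empty_iff_false, iff_false]
      exact fun h => h.1.1 (hKA h.2)
    simp [this]
  have huniv : (c • μ.restrict K) univ = 1 := by
    rw [Measure.smul_apply, Measure.restrict_apply_univ, ENNReal.smul_def, smul_eq_mul, hc,
      ENNReal.inv_mul_cancel h0 hfin]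
  refine le_trans ?_ (inv_energy_le_innerCap hmem huniv)
  rw [ENNReal.le_inv_iff_le_inv, ENNReal.inv_pow, energy_smul_left, energy_smul_right, hc, sq]
  gcongr
  refine mul_le_of_le_one_right bot_le ?_
  exact (energy_mono κ Measure.restrict_le_self).trans h1

/-- On measurable sets, the inner capacity is the square of `cap`. -/
theorem innerCap_eq_sq_cap (hE : EnergyPrinciple κ) {A : Set X} (hA : MeasurableSet A) :
    innerCap κ A = cap κ A ^ 2 := by
  refine le_antisymm (innerCap_le_sq_cap hE A) ?_
  have h : cap κ A ≤ innerCap κ A ^ (2⁻¹ : ℝ) := by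
    refine cap_le fun μ hμ h1 => ?_
    have := hμ.1.1
    rw [hA.measure_eq_iSup_isCompact]
    refine iSup₂_le fun K hKA => iSup_le fun hK => ?_
    rw [ENNReal.le_rpow_inv_iff two_pos, ENNReal.rpow_ofNat]
    exact sq_measure_le_innerCap hμ h1 hA hK hKA
  rwa [ENNReal.le_rpow_inv_iff two_pos, ENNReal.rpow_ofNat] at h

end InnerCapacity

/-- Capacitability of Borel sets in a perfectly normal, σ-compact locally compact
space endowed with a perfect kernel. -/
theorem statement9 [SigmaCompactSpace X] [NormalSpace X]
    (hPN : ∀ F : Set X, IsClosed F → ∃ U : ℕ → Set X, (∀ n, IsOpen (U n)) ∧ F = ⋂ n, U n)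
    (κ : X → X → ℝ≥0∞) (hker : IsKernel κ)
    (hE : EnergyPrinciple κ) (hC : Consistent κ) :
    ∀ B : Set X, MeasurableSet B → innerCap κ B = outerCap κ B := by
  intro B hB
  rw [innerCap_eq_sq_cap hE hB]
  refine le_antisymm (le_iInf₂ fun D hD => ?_) ?_
  · rw [innerCap_eq_sq_cap hE hD.1.measurableSet]
    exact pow_le_pow_left' (cap_mono hD.2) 2
  · have h : outerCap κ B ^ (2⁻¹ : ℝ) ≤ ocap κ B := le_iInf₂ fun D hD => by
      rw [ENNReal.rpow_inv_le_iff two_pos, ENNReal.rpow_ofNat,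
        ← innerCap_eq_sq_cap hE hD.1.measurableSet]
      exact iInf₂_le (f := fun D _ => innerCap κ D) D hD
    rwa [ENNReal.rpow_inv_le_iff two_pos, ENNReal.rpow_ofNat,
      ocap_eq_cap_of_measurableSet hPN hker hE hC hB] at h

end Balayage
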